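/- Fix p ≥ 2n−1 and set Λ_p = sup{λ_{1,p}(γ) : γ ∈ R_g}. Let α ∈ R_g^* with λ_{1,p}(α) = Λ_p. Then α belongs to 𝒞; that is, α is continuously differentiable on all of [0,1], |α'(t)|_g = L_g(α) for every t ∈ [0,1], α(1) ∈ ∂P ∖ {(0,0)}, and α'(1) is orthogonal to ∂P. -/

import Mathlib

open Set MeasureTheory Filter Topology

noncomputable section

/-- The closed quarter plane `P`. -/
def Pset : Set (ℝ × ℝ) := {z | 0 ≤ z.1 ∧ 0 ≤ z.2}

/-- The interior `P°` of the quarter plane. -/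
def Pint : Set (ℝ × ℝ) := {z | 0 < z.1 ∧ 0 < z.2}

/-- The boundary `∂P` of the quarter plane. -/
def Pbdry : Set (ℝ × ℝ) := {z | (0 ≤ z.1 ∧ 0 ≤ z.2) ∧ (z.1 = 0 ∨ z.2 = 0)}

/-- `F(x,y) = c_n x^(n-1) y^(n-1)`. -/
def Fvol (n : ℕ) (cn : ℝ) (z : ℝ × ℝ) : ℝ := cn * z.1 ^ (n - 1) * z.2 ^ (n - 1)

/-- Euclidean speed of a curve at `t`, computed with derivatives within `s`. -/
def gSpeedOn (s : Set ℝ) (α : ℝ → ℝ × ℝ) (t : ℝ) : ℝ :=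
  Real.sqrt ((derivWithin (fun u => (α u).1) s t) ^ 2 + (derivWithin (fun u => (α u).2) s t) ^ 2)

/-- Euclidean speed of a curve defined on `[0,1]`. -/
def gSpeed (α : ℝ → ℝ × ℝ) : ℝ → ℝ := gSpeedOn (Icc 0 1) α

/-- Euclidean length `L_g` of a curve on `[0,1]`. -/
def Lg (α : ℝ → ℝ × ℝ) : ℝ := ∫ t in (0:ℝ)..1, gSpeed α t

/-- The `h`-speed `|γ'|_h = F(γ) |γ'|_g`, with derivatives within `s`. -/
def hSpeedOn (n : ℕ) (cn : ℝ) (s : Set ℝ) (α : ℝ → ℝ × ℝ) (t : ℝ) : ℝ :=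
  Fvol n cn (α t) * gSpeedOn s α t

/-- The `h`-speed for curves defined on `[0,1)`. -/
def hSpeed (n : ℕ) (cn : ℝ) (α : ℝ → ℝ × ℝ) : ℝ → ℝ := hSpeedOn n cn (Ico 0 1) α

/-- The `h`-length `L_h` of a curve on `[0,1)`. -/
def Lh (n : ℕ) (cn : ℝ) (α : ℝ → ℝ × ℝ) : ℝ := ∫ t in (0:ℝ)..1, hSpeed n cn α t

/-- Numerator integrand of the `g`-Rayleigh quotient:
`|w'(t)|^p F(α t) |α'(t)|_g^(1-p)`. -/
def numG (n : ℕ) (cn p : ℝ) (s : Set ℝ) (α : ℝ → ℝ × ℝ) (w : ℝ → ℝ) (t : ℝ) : ℝ :=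
  |derivWithin w (Icc 0 1) t| ^ p * Fvol n cn (α t) * gSpeedOn s α t ^ (1 - p)

/-- Denominator integrand of the `g`-Rayleigh quotient:
`|w(t)|^p F(α t) |α'(t)|_g`. -/
def denG (n : ℕ) (cn p : ℝ) (s : Set ℝ) (α : ℝ → ℝ × ℝ) (w : ℝ → ℝ) (t : ℝ) : ℝ :=
  |w t| ^ p * Fvol n cn (α t) * gSpeedOn s α t

/-- First Dirichlet eigenvalue of the `p`-Laplacian along a curve, `g`-form:
infimum of the Rayleigh quotient over Lipschitz test functions on `[0,1]`
vanishing at `0` (with admissible, i.e. integrable with positive denominator,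
Rayleigh quotients). -/
def lambdaGOn (n : ℕ) (cn p : ℝ) (s : Set ℝ) (α : ℝ → ℝ × ℝ) : ℝ :=
  sInf {q | ∃ w : ℝ → ℝ, (∃ K, LipschitzOnWith K w (Icc 0 1)) ∧ w 0 = 0 ∧
    IntervalIntegrable (numG n cn p s α w) volume 0 1 ∧
    IntervalIntegrable (denG n cn p s α w) volume 0 1 ∧
    (0 < ∫ t in (0:ℝ)..1, denG n cn p s α w t) ∧
    q = (∫ t in (0:ℝ)..1, numG n cn p s α w t) / (∫ t in (0:ℝ)..1, denG n cn p s α w t)}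

/-- `λ_{1,p}` in the `g`-form for curves on `[0,1]`. -/
def lambdaG (n : ℕ) (cn p : ℝ) (α : ℝ → ℝ × ℝ) : ℝ := lambdaGOn n cn p (Icc 0 1) α

/-- Numerator integrand of the `h`-Rayleigh quotient on `[c,d]`:
`|w'(t)|^p F(γ t)^p |γ'(t)|_h^(1-p)`. -/
def numH (n : ℕ) (cn p c d : ℝ) (s : Set ℝ) (γ : ℝ → ℝ × ℝ) (w : ℝ → ℝ) (t : ℝ) : ℝ :=
  |derivWithin w (Icc c d) t| ^ p * Fvol n cn (γ t) ^ p * hSpeedOn n cn s γ t ^ (1 - p)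

/-- Denominator integrand of the `h`-Rayleigh quotient: `|w(t)|^p |γ'(t)|_h`. -/
def denH (n : ℕ) (cn p : ℝ) (s : Set ℝ) (γ : ℝ → ℝ × ℝ) (w : ℝ → ℝ) (t : ℝ) : ℝ :=
  |w t| ^ p * hSpeedOn n cn s γ t

/-- `λ_{1,p}` in the `h`-form for a curve on `[c,d)`, with test functions
Lipschitz on `[c,d]` vanishing at `c`. -/
def lambdaHOn (n : ℕ) (cn p c d : ℝ) (s : Set ℝ) (γ : ℝ → ℝ × ℝ) : ℝ :=
  sInf {q | ∃ w : ℝ → ℝ, (∃ K, LipschitzOnWith K w (Icc c d)) ∧ w c = 0 ∧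
    IntervalIntegrable (numH n cn p c d s γ w) volume c d ∧
    IntervalIntegrable (denH n cn p s γ w) volume c d ∧
    (0 < ∫ t in c..d, denH n cn p s γ w t) ∧
    q = (∫ t in c..d, numH n cn p c d s γ w t) / (∫ t in c..d, denH n cn p s γ w t)}

/-- `λ_{1,p}` in the `h`-form for curves on `[0,1)`. -/
def lambdaH (n : ℕ) (cn p : ℝ) (γ : ℝ → ℝ × ℝ) : ℝ :=
  lambdaHOn n cn p 0 1 (Ico 0 1) γ

/-- The class `𝒞` of `C¹` curves from `(x₀,y₀)` to the boundary, with constant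
speed, interior image on `[0,1)`, endpoint away from the origin, and meeting the
boundary orthogonally. -/
def MemC (x0 y0 : ℝ) (α : ℝ → ℝ × ℝ) : Prop :=
  ContDiffOn ℝ 1 α (Icc 0 1) ∧
  α 0 = (x0, y0) ∧
  (∀ t ∈ Ico (0:ℝ) 1, α t ∈ Pint) ∧
  α 1 ∈ Pbdry ∧ α 1 ≠ ((0 : ℝ), (0 : ℝ)) ∧
  (∀ t ∈ Icc (0:ℝ) 1, gSpeed α t = Lg α) ∧
  ((α 1).1 = 0 → derivWithin (fun u => (α u).2) (Icc 0 1) 1 = 0) ∧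
  ((α 1).2 = 0 → derivWithin (fun u => (α u).1) (Icc 0 1) 1 = 0)

/-- The Simons cone curve `σ(t) = (1-t)·(R,R)`. -/
def simonsCurve (R : ℝ) : ℝ → ℝ × ℝ := fun t => ((1 - t) * R, (1 - t) * R)

/-- The class `R_h`: locally Lipschitz curves on `[0,1)` with image in `P°`,
starting at `(x₀,y₀)`, with essentially bounded `h`-speed, reaching the collapsed
boundary point as `t → 1` (i.e. `x(γ t)·y(γ t) → 0`). -/
def MemRh (n : ℕ) (cn x0 y0 : ℝ) (γ : ℝ → ℝ × ℝ) : Prop :=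
  γ 0 = (x0, y0) ∧
  (∀ t ∈ Ico (0:ℝ) 1, γ t ∈ Pint) ∧
  (∀ a ∈ Ico (0:ℝ) 1, ∃ K, LipschitzOnWith K γ (Icc 0 a)) ∧
  (∃ M : ℝ, ∀ᵐ t ∂(volume : Measure ℝ), t ∈ Ico (0:ℝ) 1 → hSpeed n cn γ t ≤ M) ∧
  Tendsto (fun t => (γ t).1 * (γ t).2) (𝓝[<] (1:ℝ)) (𝓝 0)

/-- The class `R_h^+`: continuous curves on `[0,1]` into `P` ending on `∂P`
whose restriction to `[0,1)` belongs to `R_h`. -/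
def MemRhPlus (n : ℕ) (cn x0 y0 : ℝ) (α : ℝ → ℝ × ℝ) : Prop :=
  ContinuousOn α (Icc 0 1) ∧ (∀ t ∈ Icc (0:ℝ) 1, α t ∈ Pset) ∧ α 1 ∈ Pbdry ∧
  MemRh n cn x0 y0 α

/-- The class `R_g`: Lipschitz curves on `[0,1]` from `(x₀,y₀)` to `∂P` with
interior image on `[0,1)`. -/
def MemRg (x0 y0 : ℝ) (α : ℝ → ℝ × ℝ) : Prop :=
  (∃ K, LipschitzOnWith K α (Icc 0 1)) ∧ α 0 = (x0, y0) ∧ α 1 ∈ Pbdry ∧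
  ∀ t ∈ Ico (0:ℝ) 1, α t ∈ Pint

/-- The coordinate `u(x,y) = (x² - y²)/2`. -/
def ucoord (z : ℝ × ℝ) : ℝ := (z.1 ^ 2 - z.2 ^ 2) / 2

/-- The coordinate `v(x,y) = xy`. -/
def vcoord (z : ℝ × ℝ) : ℝ := z.1 * z.2

/-- The coordinate `r = √(u² + v²)`. -/
def rcoord (z : ℝ × ℝ) : ℝ := Real.sqrt (ucoord z ^ 2 + vcoord z ^ 2)

/-- The class `R_g^*`: simple curves in `R_g` with a.e. constant speed,
`u(α(1)) > 0`, and `v(α(t)) ≥ c(1-t)` for some `c > 0`. -/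
def MemRgStar (x0 y0 : ℝ) (α : ℝ → ℝ × ℝ) : Prop :=
  MemRg x0 y0 α ∧ InjOn α (Icc 0 1) ∧
  (∀ᵐ t ∂(volume : Measure ℝ), t ∈ Icc (0:ℝ) 1 → gSpeed α t = Lg α) ∧
  0 < ucoord (α 1) ∧
  ∃ c > (0:ℝ), ∀ t ∈ Icc (0:ℝ) 1, c * (1 - t) ≤ vcoord (α t)

/-- Measurable and bounded functions on `[0,1]`. -/
def BddMeas (g : ℝ → ℝ) : Prop :=
  AEStronglyMeasurable g (volume.restrict (Icc (0:ℝ) 1)) ∧ ∃ K, ∀ t ∈ Icc (0:ℝ) 1, |g t| ≤ K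

namespace BddMeas

variable {f g : ℝ → ℝ}

theorem const (c : ℝ) : BddMeas fun _ => c := ⟨aestronglyMeasurable_const, |c|, fun _ _ => le_rfl⟩

theorem of_continuousOn (hg : ContinuousOn g (Icc 0 1)) : BddMeas g := by
  obtain ⟨K, hK⟩ := isCompact_Icc.exists_bound_of_continuousOn hg
  exact ⟨hg.aestronglyMeasurable measurableSet_Icc, K, hK⟩

theorem add (hf : BddMeas f) (hg : BddMeas g) : BddMeas fun t => f t + g t := by
  obtain ⟨hf, K, hK⟩ := hf
  obtain ⟨hg, M, hM⟩ := hg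
  exact ⟨hf.add hg, K + M, fun t ht => (abs_add_le _ _).trans (add_le_add (hK t ht) (hM t ht))⟩

theorem mul (hf : BddMeas f) (hg : BddMeas g) : BddMeas fun t => f t * g t := by
  obtain ⟨hf, K, hK⟩ := hf
  obtain ⟨hg, M, hM⟩ := hg
  refine ⟨hf.mul hg, K * M, fun t ht => ?_⟩
  rw [abs_mul]
  exact mul_le_mul (hK t ht) (hM t ht) (abs_nonneg _) ((abs_nonneg _).trans (hK t ht))

theorem rpow (hf : BddMeas f) {p : ℝ} (hp : 0 ≤ p) : BddMeas fun t => f t ^ p := by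
  obtain ⟨hf, K, hK⟩ := hf
  refine ⟨(hf.aemeasurable.pow_const p).aestronglyMeasurable, K ^ p, fun t ht => ?_⟩
  exact (Real.abs_rpow_le_abs_rpow _ _).trans
    (Real.rpow_le_rpow (abs_nonneg _) (hK t ht) hp)

theorem ite (hf : BddMeas f) (hg : BddMeas g) (m : ℝ) :
    BddMeas fun t => if t ≤ m then f t else g t := by
  obtain ⟨hf, K, hK⟩ := hf
  obtain ⟨hg, M, hM⟩ := hg
  refine ⟨?_, max K M, fun t ht => ?_⟩
  · have : (fun t => if t ≤ m then f t else g t) =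
        fun t => (Iic m).indicator f t + (Ioi m).indicator g t := by
      ext t
      by_cases h : t ≤ m
      · simp [h, indicator]
      · simp [h, indicator, not_le.1 h]
    rw [this]
    exact (hf.indicator measurableSet_Iic).add (hg.indicator measurableSet_Ioi)
  · dsimp only
    split_ifs
    · exact (hK t ht).trans (le_max_left _ _)
    · exact (hM t ht).trans (le_max_right _ _)

theorem integrableOn (hf : BddMeas f) : IntegrableOn f (Icc 0 1) := by
  obtain ⟨hf, K, hK⟩ := hf
  exact Integrable.of_bound hf K
    ((ae_restrict_iff' measurableSet_Icc).2 (Eventually.of_forall hK))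

theorem intervalIntegrable (hf : BddMeas f) {a b : ℝ} (ha : a ∈ Icc (0:ℝ) 1)
    (hb : b ∈ Icc (0:ℝ) 1) : IntervalIntegrable f volume a b :=
  (hf.integrableOn.mono_set (uIcc_subset_Icc ha hb)).intervalIntegrable

end BddMeas

/-- The primitive of `g` vanishing at `0`. -/
def prim (g : ℝ → ℝ) (t : ℝ) : ℝ := ∫ s in (0:ℝ)..t, g s

/-- The weighted `p`-energy of a function with derivative `g`. -/
def energy (p : ℝ) (A g : ℝ → ℝ) (a b : ℝ) : ℝ := ∫ t in a..b, g t ^ p * A t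

/-- The weighted `p`-mass of the primitive of `g`. -/
def mass (p : ℝ) (B g : ℝ → ℝ) (a b : ℝ) : ℝ := ∫ t in a..b, prim g t ^ p * B t

/-- Bounded, measurable, nonnegative functions on `[0,1]`. -/
structure TestDensity (g : ℝ → ℝ) : Prop where
  meas : BddMeas g
  nonneg : ∀ t ∈ Icc (0:ℝ) 1, 0 ≤ g t

theorem zero_mem_unit : (0:ℝ) ∈ Icc (0:ℝ) 1 := ⟨le_rfl, zero_le_one⟩
theorem one_mem_unit : (1:ℝ) ∈ Icc (0:ℝ) 1 := ⟨zero_le_one, le_rfl⟩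

theorem BddMeas.integral_nonneg_of {f : ℝ → ℝ} (hf : ∀ t ∈ Icc (0:ℝ) 1, 0 ≤ f t) {a b : ℝ}
    (ha : a ∈ Icc (0:ℝ) 1) (hb : b ∈ Icc (0:ℝ) 1) (hab : a ≤ b) : 0 ≤ ∫ t in a..b, f t :=
  intervalIntegral.integral_nonneg hab fun t ht => hf t ⟨ha.1.trans ht.1, ht.2.trans hb.2⟩

theorem BddMeas.integral_add_adjacent {f : ℝ → ℝ} (hf : BddMeas f) {a b c : ℝ}
    (ha : a ∈ Icc (0:ℝ) 1) (hb : b ∈ Icc (0:ℝ) 1) (hc : c ∈ Icc (0:ℝ) 1) :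
    (∫ t in a..b, f t) + ∫ t in b..c, f t = ∫ t in a..c, f t :=
  intervalIntegral.integral_add_adjacent_intervals (hf.intervalIntegrable ha hb)
    (hf.intervalIntegrable hb hc)

theorem BddMeas.integral_le {f g : ℝ → ℝ} (hf : BddMeas f) (hg : BddMeas g) {a b : ℝ}
    (ha : a ∈ Icc (0:ℝ) 1) (hb : b ∈ Icc (0:ℝ) 1) (hab : a ≤ b)
    (h : ∀ t ∈ Ioo a b, f t ≤ g t) : ∫ t in a..b, f t ≤ ∫ t in a..b, g t :=
  intervalIntegral.integral_mono_on_of_le_Ioo hab (hf.intervalIntegrable ha hb)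
    (hg.intervalIntegrable ha hb) h

theorem integral_congr_Ioo {f g : ℝ → ℝ} {a b : ℝ} (hab : a ≤ b)
    (h : ∀ t ∈ Ioo a b, f t = g t) : ∫ t in a..b, f t = ∫ t in a..b, g t := by
  rw [intervalIntegral.integral_of_le hab, intervalIntegral.integral_of_le hab,
    integral_Ioc_eq_integral_Ioo, integral_Ioc_eq_integral_Ioo]
  exact setIntegral_congr_fun measurableSet_Ioo h

namespace TestDensity

variable {g : ℝ → ℝ}

theorem prim_sub (hg : TestDensity g) {s t : ℝ} (hs : s ∈ Icc (0:ℝ) 1) (ht : t ∈ Icc (0:ℝ) 1) :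
    prim g t = prim g s + ∫ r in s..t, g r :=
  (hg.meas.integral_add_adjacent zero_mem_unit hs ht).symm

theorem prim_mono (hg : TestDensity g) {s t : ℝ} (hs : s ∈ Icc (0:ℝ) 1) (ht : t ∈ Icc (0:ℝ) 1)
    (hst : s ≤ t) : prim g s ≤ prim g t := by
  rw [hg.prim_sub hs ht]
  linarith [BddMeas.integral_nonneg_of hg.nonneg hs ht hst]

theorem prim_nonneg (hg : TestDensity g) {t : ℝ} (ht : t ∈ Icc (0:ℝ) 1) : 0 ≤ prim g t :=
  BddMeas.integral_nonneg_of hg.nonneg zero_mem_unit ht ht.1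

theorem prim_continuousOn (hg : TestDensity g) : ContinuousOn (prim g) (Icc 0 1) := by
  have := intervalIntegral.continuousOn_primitive_interval (μ := volume) (f := g) (a := 0) (b := 1)
    (by rw [uIcc_of_le zero_le_one]; exact hg.meas.integrableOn)
  rwa [uIcc_of_le zero_le_one] at this

theorem prim_bddMeas (hg : TestDensity g) : BddMeas (prim g) :=
  BddMeas.of_continuousOn hg.prim_continuousOn

theorem energy_bddMeas (hg : TestDensity g) {A : ℝ → ℝ} (hA : BddMeas A) {p : ℝ} (hp : 0 ≤ p) :
    BddMeas fun t => g t ^ p * A t := (hg.meas.rpow hp).mul hA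

theorem mass_bddMeas (hg : TestDensity g) {B : ℝ → ℝ} (hB : BddMeas B) {p : ℝ} (hp : 0 ≤ p) :
    BddMeas fun t => prim g t ^ p * B t := (hg.prim_bddMeas.rpow hp).mul hB

theorem energy_nonneg (hg : TestDensity g) {A : ℝ → ℝ} (hA : ∀ t ∈ Icc (0:ℝ) 1, 0 ≤ A t) {p : ℝ}
    {a b : ℝ} (ha : a ∈ Icc (0:ℝ) 1) (hb : b ∈ Icc (0:ℝ) 1) (hab : a ≤ b) :
    0 ≤ energy p A g a b :=
  BddMeas.integral_nonneg_of
    (fun t ht => mul_nonneg (Real.rpow_nonneg (hg.nonneg t ht) _) (hA t ht)) ha hb hab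

theorem mass_nonneg (hg : TestDensity g) {B : ℝ → ℝ} (hB : ∀ t ∈ Icc (0:ℝ) 1, 0 ≤ B t) {p : ℝ}
    {a b : ℝ} (ha : a ∈ Icc (0:ℝ) 1) (hb : b ∈ Icc (0:ℝ) 1) (hab : a ≤ b) :
    0 ≤ mass p B g a b :=
  BddMeas.integral_nonneg_of
    (fun t ht => mul_nonneg (Real.rpow_nonneg (hg.prim_nonneg ht) _) (hB t ht)) ha hb hab

theorem energy_add (hg : TestDensity g) {A : ℝ → ℝ} (hA : BddMeas A) {p : ℝ} (hp : 0 ≤ p)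
    {a b c : ℝ} (ha : a ∈ Icc (0:ℝ) 1) (hb : b ∈ Icc (0:ℝ) 1) (hc : c ∈ Icc (0:ℝ) 1) :
    energy p A g a c = energy p A g a b + energy p A g b c :=
  ((hg.energy_bddMeas hA hp).integral_add_adjacent ha hb hc).symm

theorem mass_add (hg : TestDensity g) {B : ℝ → ℝ} (hB : BddMeas B) {p : ℝ} (hp : 0 ≤ p)
    {a b c : ℝ} (ha : a ∈ Icc (0:ℝ) 1) (hb : b ∈ Icc (0:ℝ) 1) (hc : c ∈ Icc (0:ℝ) 1) :
    mass p B g a c = mass p B g a b + mass p B g b c :=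
  ((hg.mass_bddMeas hB hp).integral_add_adjacent ha hb hc).symm

/-- The mass over an interval is at most the right end value times the total weight. -/
theorem mass_le (hg : TestDensity g) {B : ℝ → ℝ} (hB : BddMeas B)
    (hB0 : ∀ t ∈ Icc (0:ℝ) 1, 0 ≤ B t) {p : ℝ} (hp : 0 ≤ p)
    {a b : ℝ} (ha : a ∈ Icc (0:ℝ) 1) (hb : b ∈ Icc (0:ℝ) 1) (hab : a ≤ b) :
    mass p B g a b ≤ prim g b ^ p * ∫ t in a..b, B t := by
  rw [← intervalIntegral.integral_const_mul]
  refine (hg.mass_bddMeas hB hp).integral_le ((BddMeas.const _).mul hB) ha hb hab fun t ht => ?_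
  have ht' : t ∈ Icc (0:ℝ) 1 := ⟨ha.1.trans ht.1.le, ht.2.le.trans hb.2⟩
  exact mul_le_mul_of_nonneg_right
    (Real.rpow_le_rpow (hg.prim_nonneg ht') (hg.prim_mono ht' hb ht.2.le) hp) (hB0 t ht')

/-- The mass over an interval is at least the left end value times the total weight. -/
theorem le_mass (hg : TestDensity g) {B : ℝ → ℝ} (hB : BddMeas B)
    (hB0 : ∀ t ∈ Icc (0:ℝ) 1, 0 ≤ B t) {p : ℝ} (hp : 0 ≤ p)
    {a b : ℝ} (ha : a ∈ Icc (0:ℝ) 1) (hb : b ∈ Icc (0:ℝ) 1) (hab : a ≤ b) :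
    prim g a ^ p * ∫ t in a..b, B t ≤ mass p B g a b := by
  rw [← intervalIntegral.integral_const_mul]
  refine ((BddMeas.const _).mul hB).integral_le (hg.mass_bddMeas hB hp) ha hb hab fun t ht => ?_
  have ht' : t ∈ Icc (0:ℝ) 1 := ⟨ha.1.trans ht.1.le, ht.2.le.trans hb.2⟩
  exact mul_le_mul_of_nonneg_right
    (Real.rpow_le_rpow (hg.prim_nonneg ha) (hg.prim_mono ha ht' ht.1.le) hp) (hB0 t ht')

end TestDensity

theorem young_tangent {p X Y : ℝ} (hp : 1 < p) (hX : 0 ≤ X) (hY : 0 ≤ Y) :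
    p * X * Y ^ (p - 1) ≤ X ^ p + (p - 1) * Y ^ p := by
  have h := Real.young_inequality_of_nonneg hX (Real.rpow_nonneg hY (p - 1))
    (Real.HolderConjugate.conjExponent hp)
  have hp1 : p - 1 ≠ 0 := by linarith
  have hp0 : p ≠ 0 := by linarith
  rw [Real.conjExponent, ← Real.rpow_mul hY, mul_div_cancel₀ _ hp1] at h
  have h2 := mul_le_mul_of_nonneg_left h (by linarith : (0:ℝ) ≤ p)
  have e : p * (X ^ p / p + Y ^ p / (p / (p - 1))) = X ^ p + (p - 1) * Y ^ p := by
    field_simp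
  rw [e] at h2
  linarith

theorem intervalIntegrable_inv_sqrt (a : ℝ) :
    IntervalIntegrable (fun t : ℝ => (1 - t) ^ (-(1/2) : ℝ)) volume a 1 := by
  have h := (intervalIntegral.intervalIntegrable_rpow' (a := 1 - a) (b := 0) (r := -(1/2))
    (by norm_num)).comp_sub_left 1
  simpa using h

theorem integral_inv_sqrt_le {a : ℝ} (ha : a ∈ Icc (0:ℝ) 1) :
    ∫ t in a..1, (1 - t) ^ (-(1/2) : ℝ) ≤ 2 := by
  rw [intervalIntegral.integral_comp_sub_left (fun x : ℝ => x ^ (-(1/2) : ℝ)),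
    integral_rpow (Or.inl (by norm_num))]
  have : (1 - a) ^ (-(1/2) + 1 : ℝ) ≤ 1 :=
    Real.rpow_le_one (by linarith [ha.2]) (by linarith [ha.1]) (by norm_num)
  rw [sub_self, Real.zero_rpow (by norm_num), div_le_iff₀ (by norm_num)]
  linarith

theorem TestDensity.rpow_integral_le {g A : ℝ → ℝ} (hg : TestDensity g) (hA : BddMeas A) {n : ℕ}
    (hn : 2 ≤ n) {p : ℝ} (hp : 2 * (n : ℝ) - 1 ≤ p) {a c : ℝ} (ha : a ∈ Icc (0:ℝ) 1) (hc : 0 < c)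
    (hAc : ∀ t ∈ Ioo a 1, c * (1 - t) ^ (n - 1) ≤ A t) :
    c * (∫ t in a..1, g t) ^ p ≤ 2 ^ (p - 1) * energy p A g a 1 := by
  have hn' : (2:ℝ) ≤ n := by exact_mod_cast hn
  have hp1 : 1 < p := by linarith
  set J := ∫ t in a..1, g t with hJ
  have hJ0 : 0 ≤ J := BddMeas.integral_nonneg_of hg.nonneg ha one_mem_unit ha.2
  have hpt : ∀ t ∈ Ioo a 1, c * (p * (J / 2) ^ (p - 1)) * g t
      - c * ((p - 1) * (J / 2) ^ p) * (1 - t) ^ (-(1/2) : ℝ) ≤ g t ^ p * A t := by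
    intro t ht
    have ht1 : 0 < 1 - t := by linarith [ht.2]
    have ht1' : 1 - t ≤ 1 := by linarith [ht.1, ha.1]
    have hg0 : 0 ≤ g t := hg.nonneg t ⟨ha.1.trans ht.1.le, ht.2.le⟩
    set k : ℝ := ((n : ℝ) - 1) / (p - 1) with hk
    have hkp : k * (p - 1) = n - 1 := by rw [hk]; field_simp [(by linarith : p - 1 ≠ 0)]
    have hk2 : k ≤ 1/2 := by
      rw [hk, div_le_iff₀ (by linarith)]; linarith
    set ρ := (1 - t) ^ (-k) with hρ
    have hρ0 : 0 < ρ := Real.rpow_pos_of_pos ht1 _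
    have hρle : ρ ≤ (1 - t) ^ (-(1/2) : ℝ) :=
      Real.rpow_le_rpow_of_exponent_ge ht1 ht1' (by linarith)
    have he : (1 - t) ^ (n - 1) * ρ ^ (p - 1) = 1 := by
      rw [hρ, ← Real.rpow_mul ht1.le, ← Real.rpow_natCast, ← Real.rpow_add ht1,
        Nat.cast_sub (by omega)]
      push_cast
      rw [neg_mul, hkp]; simp
    have he2 : (1 - t) ^ (n - 1) * ρ ^ p = ρ := by
      have : ρ ^ p = ρ ^ (p - 1) * ρ := by
        rw [← Real.rpow_add_one hρ0.ne']; ring_nf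
      rw [this, ← mul_assoc, he, one_mul]
    have hy := young_tangent hp1 hg0 (mul_nonneg (by linarith : 0 ≤ J / 2) hρ0.le)
    rw [Real.mul_rpow (by linarith) hρ0.le, Real.mul_rpow (by linarith) hρ0.le] at hy
    have h1 := mul_le_mul_of_nonneg_left hy (pow_nonneg ht1.le (n - 1))
    have e1 : (1 - t) ^ (n - 1) * (p * g t * ((J / 2) ^ (p - 1) * ρ ^ (p - 1)))
        = p * (J / 2) ^ (p - 1) * g t := by
      linear_combination (p * g t * (J / 2) ^ (p - 1)) * he
    have e2 : (1 - t) ^ (n - 1) * (g t ^ p + (p - 1) * ((J / 2) ^ p * ρ ^ p))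
        = (1 - t) ^ (n - 1) * g t ^ p + (p - 1) * (J / 2) ^ p * ρ := by
      linear_combination ((p - 1) * (J / 2) ^ p) * he2
    rw [e1, e2] at h1
    have h2 : (p - 1) * (J / 2) ^ p * ρ ≤ (p - 1) * (J / 2) ^ p * (1 - t) ^ (-(1/2) : ℝ) :=
      mul_le_mul_of_nonneg_left hρle
        (mul_nonneg (by linarith) (Real.rpow_nonneg (by linarith) _))
    have h3 := mul_le_mul_of_nonneg_left (hAc t ht) (Real.rpow_nonneg hg0 p)
    have h4 := mul_le_mul_of_nonneg_left (h1.trans (add_le_add_right h2 _)) hc.le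
    linarith
  have hint := intervalIntegral.integral_mono_on_of_le_Ioo ha.2
    (((hg.meas.intervalIntegrable ha one_mem_unit).const_mul _).sub
      ((intervalIntegrable_inv_sqrt a).const_mul _))
    ((hg.energy_bddMeas hA (by linarith : 0 ≤ p)).intervalIntegrable ha one_mem_unit) hpt
  rw [intervalIntegral.integral_sub ((hg.meas.intervalIntegrable ha one_mem_unit).const_mul _)
      ((intervalIntegrable_inv_sqrt a).const_mul _), intervalIntegral.integral_const_mul,
      intervalIntegral.integral_const_mul, ← hJ] at hint
  have h5 : c * ((p - 1) * (J / 2) ^ p) * ∫ t in a..1, (1 - t) ^ (-(1/2) : ℝ)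
      ≤ c * ((p - 1) * (J / 2) ^ p) * 2 :=
    mul_le_mul_of_nonneg_left (integral_inv_sqrt_le ha)
      (mul_nonneg hc.le (mul_nonneg (by linarith) (Real.rpow_nonneg (by linarith) _)))
  change _ ≤ energy p A g a 1 at hint
  have e3 : (J / 2) ^ (p - 1) * J = (J / 2) ^ p * 2 := by
    have : (J / 2) ^ (p - 1) * (J / 2) = (J / 2) ^ p := by
      rw [← Real.rpow_add_one' (by linarith) (by linarith)]; ring_nf
    linear_combination 2 * this
  have h6 : c * ((J / 2) ^ p * 2) ≤ energy p A g a 1 := by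
    have : c * (p * (J / 2) ^ (p - 1)) * J = c * p * ((J / 2) ^ p * 2) := by
      rw [← e3]; ring
    rw [this] at hint
    nlinarith
  have e4 : (J / 2) ^ p * 2 * 2 ^ (p - 1) = J ^ p := by
    rw [Real.div_rpow hJ0 (by norm_num), Real.rpow_sub_one (by norm_num)]
    have : (2:ℝ) ^ p ≠ 0 := (Real.rpow_pos_of_pos (by norm_num) _).ne'
    field_simp
  rw [← e4]
  have := mul_le_mul_of_nonneg_left h6 (Real.rpow_nonneg (by norm_num : (0:ℝ) ≤ 2) (p - 1))
  linarith

section Ite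
variable {g₁ g₂ : ℝ → ℝ} {m : ℝ}

theorem TestDensity.ite (h₁ : TestDensity g₁) (h₂ : TestDensity g₂) (m : ℝ) :
    TestDensity fun t => if t ≤ m then g₁ t else g₂ t where
  meas := h₁.meas.ite h₂.meas m
  nonneg t ht := by
    split_ifs
    · exact h₁.nonneg t ht
    · exact h₂.nonneg t ht

theorem prim_ite_of_le {t : ℝ} (h0 : 0 ≤ t) (ht : t ≤ m) :
    prim (fun t => if t ≤ m then g₁ t else g₂ t) t = prim g₁ t :=
  integral_congr_Ioo h0 fun _ hs => if_pos (hs.2.le.trans ht)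

theorem prim_ite_of_ge (h₁ : TestDensity g₁) (h₂ : TestDensity g₂) (hm : m ∈ Icc (0:ℝ) 1) {t : ℝ}
    (hmt : m ≤ t) (ht : t ≤ 1) :
    prim (fun t => if t ≤ m then g₁ t else g₂ t) t = prim g₁ m + ∫ s in m..t, g₂ s := by
  rw [(h₁.ite h₂ m).prim_sub hm ⟨hm.1.trans hmt, ht⟩, prim_ite_of_le hm.1 le_rfl]
  congr 1
  exact integral_congr_Ioo hmt fun _ hs => if_neg (not_le.2 hs.1)

theorem energy_ite (h₁ : TestDensity g₁) (h₂ : TestDensity g₂) (hm : m ∈ Icc (0:ℝ) 1) {p : ℝ}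
    (hp : 0 ≤ p) {A : ℝ → ℝ} (hA : BddMeas A) :
    energy p A (fun t => if t ≤ m then g₁ t else g₂ t) 0 1 =
      energy p A g₁ 0 m + energy p A g₂ m 1 := by
  rw [(h₁.ite h₂ m).energy_add hA hp zero_mem_unit hm one_mem_unit]
  congr 1
  · exact integral_congr_Ioo hm.1 fun s hs => by simp only [if_pos hs.2.le]
  · exact integral_congr_Ioo hm.2 fun s hs => by simp only [if_neg (not_le.2 hs.1)]

end Ite

theorem TestDensity.const {c : ℝ} (hc : 0 ≤ c) : TestDensity fun _ => c :=
  ⟨BddMeas.const c, fun _ _ => hc⟩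

/-- Almost minimizers of the Rayleigh quotient cannot be small at an interior point. -/
theorem exists_mass_le_prim {p Λ CH m : ℝ} {A B : ℝ → ℝ} (hp : 2 ≤ p) (hA : BddMeas A)
    (hA0 : ∀ t ∈ Icc (0:ℝ) 1, 0 ≤ A t) (hB : BddMeas B) (hB0 : ∀ t ∈ Icc (0:ℝ) 1, 0 ≤ B t)
    (hΛ : 0 < Λ) (htest : ∀ g, TestDensity g → Λ * mass p B g 0 1 ≤ energy p A g 0 1)
    (hCH : 0 ≤ CH) (hH : ∀ g, TestDensity g → prim g 1 ^ p ≤ CH * energy p A g 0 1)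
    (hm : m ∈ Ioo (0:ℝ) 1) :
    ∃ τ > 0, ∃ δ > 0, ∀ g, TestDensity g → energy p A g 0 1 ≤ (Λ + δ) * mass p B g 0 1 →
      τ * mass p B g 0 1 ≤ prim g m ^ p := by
  have hp0 : 0 < p := by linarith
  have hmI : m ∈ Icc (0:ℝ) 1 := ⟨hm.1.le, hm.2.le⟩
  set b0 := ∫ t in (0:ℝ)..m, B t with hb0
  set a0 := ∫ t in (0:ℝ)..m, A t with ha0
  have hb0n : 0 ≤ b0 := BddMeas.integral_nonneg_of hB0 zero_mem_unit hmI hm.1.le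
  have ha0n : 0 ≤ a0 := BddMeas.integral_nonneg_of hA0 zero_mem_unit hmI hm.1.le
  set H := (CH * (2 * Λ)) ^ (1 / p) + 1 with hHdef
  have hHpos : 0 < H := by
    have : 0 ≤ (CH * (2 * Λ)) ^ (1 / p) := Real.rpow_nonneg (by positivity) _
    linarith
  set C1 := (2 / m) ^ p * a0 with hC1
  have hC1n : 0 ≤ C1 := mul_nonneg (Real.rpow_nonneg (div_nonneg (by norm_num) hm.1.le) _) ha0n
  set E := Λ * b0 * (1 + 1 / H) + C1 with hE
  have hEn : 0 ≤ E := by positivity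
  set τ := min 1 (Λ / (2 * H * (E + 1))) with hτ
  have hτ0 : 0 < τ := lt_min one_pos (by positivity)
  have hτ1 : τ ≤ 1 := min_le_left _ _
  have hτE : τ * E ≤ Λ / (2 * H) := by
    have : τ ≤ Λ / (2 * H * (E + 1)) := min_le_right _ _
    calc τ * E ≤ Λ / (2 * H * (E + 1)) * (E + 1) := by
          apply mul_le_mul this (by linarith) hEn (by positivity)
      _ = Λ / (2 * H) := by field_simp
  refine ⟨τ ^ p, Real.rpow_pos_of_pos hτ0 _, min Λ (Λ * τ / (4 * H)),
    lt_min hΛ (by positivity), fun g hg hle => ?_⟩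
  by_contra! hlt
  set δ := min Λ (Λ * τ / (4 * H)) with hδ
  set D := mass p B g 0 1 with hD
  have hδ1 : δ ≤ Λ := min_le_left _ _
  have hδ2 : δ ≤ Λ * τ / (4 * H) := min_le_right _ _
  have hτp : 0 < τ ^ p := Real.rpow_pos_of_pos hτ0 _
  have hDpos : 0 < D := by
    have : 0 ≤ prim g m ^ p := Real.rpow_nonneg (hg.prim_nonneg hmI) _
    by_contra! h
    nlinarith
  set R := D ^ (1 / p) with hR
  have hRpos : 0 < R := Real.rpow_pos_of_pos hDpos _
  have hRp : R ^ p = D := by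
    rw [hR, ← Real.rpow_mul hDpos.le, one_div_mul_cancel hp0.ne', Real.rpow_one]
  have hWm : prim g m ≤ τ * R := by
    rw [← Real.rpow_le_rpow_iff (hg.prim_nonneg hmI) (by positivity) hp0,
      Real.mul_rpow hτ0.le hRpos.le, hRp]
    exact hlt.le
  have hW1 : prim g 1 ≤ H * R := by
    have h1 : prim g 1 ^ p ≤ (CH * (2 * Λ)) * D := by
      have h2 : (Λ + δ) * D ≤ 2 * Λ * D := mul_le_mul_of_nonneg_right (by linarith) hDpos.le
      have := mul_le_mul_of_nonneg_left (hle.trans h2) hCH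
      linarith [hH g hg]
    have h3 : prim g 1 ≤ (CH * (2 * Λ)) ^ (1 / p) * R := by
      rw [← Real.rpow_le_rpow_iff (hg.prim_nonneg one_mem_unit)
        (mul_nonneg (Real.rpow_nonneg (by positivity) _) hRpos.le) hp0,
        Real.mul_rpow (Real.rpow_nonneg (by positivity) _) hRpos.le, hRp,
        ← Real.rpow_mul (by positivity), one_div_mul_cancel hp0.ne', Real.rpow_one]
      exact h1
    rw [hHdef]; nlinarith
  have hconst : TestDensity fun _ => 2 * τ * R / m :=
    TestDensity.const (div_nonneg (by positivity) hm.1.le)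
  set gt : ℝ → ℝ := fun t => if t ≤ m then 2 * τ * R / m else g t with hgt
  have hgtT : TestDensity gt := hconst.ite hg m
  have hprim : ∀ t ∈ Icc m 1, (1 + τ / H) * prim g t ≤ prim gt t := by
    intro t ht
    have htI : t ∈ Icc (0:ℝ) 1 := ⟨hm.1.le.trans ht.1, ht.2⟩
    rw [hgt, prim_ite_of_ge hconst hg hmI ht.1 ht.2]
    have e1 : prim (fun _ => 2 * τ * R / m) m = 2 * τ * R := by
      have := hm.1.ne'
      simp only [prim, intervalIntegral.integral_const, sub_zero, smul_eq_mul]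
      field_simp
    have e2 := hg.prim_sub hmI htI
    have h1 : prim g t ≤ H * R := (hg.prim_mono htI one_mem_unit ht.2).trans hW1
    have h2 : τ / H * prim g t ≤ τ * R := by
      calc τ / H * prim g t ≤ τ / H * (H * R) :=
            mul_le_mul_of_nonneg_left h1 (by positivity)
        _ = τ * R := by field_simp
    rw [e1]; linarith
  have hmass : (1 + τ / H) * mass p B g m 1 ≤ mass p B gt 0 1 := by
    rw [hgtT.mass_add hB hp0.le zero_mem_unit hmI one_mem_unit]
    have h1 : 0 ≤ mass p B gt 0 m := hgtT.mass_nonneg hB0 zero_mem_unit hmI hm.1.le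
    have h2 : (1 + τ / H) * mass p B g m 1 ≤ mass p B gt m 1 := by
      rw [mass, ← intervalIntegral.integral_const_mul]
      refine ((BddMeas.const _).mul (hg.mass_bddMeas hB hp0.le)).integral_le
        (hgtT.mass_bddMeas hB hp0.le) hmI one_mem_unit hm.2.le fun t ht => ?_
      have htI : t ∈ Icc (0:ℝ) 1 := ⟨hm.1.le.trans ht.1.le, ht.2.le⟩
      have hc1 : 1 ≤ 1 + τ / H := by
        have : 0 ≤ τ / H := by positivity
        linarith
      have hc : 1 + τ / H ≤ (1 + τ / H) ^ p := by
        simpa using Real.rpow_le_rpow_of_exponent_le hc1 (by linarith : (1:ℝ) ≤ p)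
      have h3 : (1 + τ / H) * prim g t ^ p ≤ prim gt t ^ p := by
        calc (1 + τ / H) * prim g t ^ p ≤ (1 + τ / H) ^ p * prim g t ^ p :=
              mul_le_mul_of_nonneg_right hc (Real.rpow_nonneg (hg.prim_nonneg htI) _)
          _ = ((1 + τ / H) * prim g t) ^ p :=
              (Real.mul_rpow (by linarith) (hg.prim_nonneg htI)).symm
          _ ≤ _ := Real.rpow_le_rpow (mul_nonneg (by linarith) (hg.prim_nonneg htI))
              (hprim t ⟨ht.1.le, ht.2.le⟩) hp0.le
      have := mul_le_mul_of_nonneg_right h3 (hB0 t htI)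
      linarith
    linarith
  have henergy : energy p A gt 0 1 ≤ C1 * τ ^ p * D + energy p A g 0 1 := by
    rw [hgt, energy_ite hconst hg hmI hp0.le hA, hg.energy_add hA hp0.le zero_mem_unit hmI
      one_mem_unit]
    have h1 : 0 ≤ energy p A g 0 m := hg.energy_nonneg hA0 zero_mem_unit hmI hm.1.le
    have h2 : energy p A (fun _ => 2 * τ * R / m) 0 m = C1 * τ ^ p * D := by
      rw [energy, intervalIntegral.integral_const_mul, ← ha0, hC1, ← hRp,
        show 2 * τ * R / m = 2 / m * τ * R by ring,
        Real.mul_rpow (mul_nonneg (div_nonneg (by norm_num) hm.1.le) hτ0.le) hRpos.le,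
        Real.mul_rpow (div_nonneg (by norm_num) hm.1.le) hτ0.le]
      ring
    linarith
  have hm0 : mass p B g 0 m ≤ τ ^ p * D * b0 :=
    (hg.mass_le hB hB0 hp0.le zero_mem_unit hmI hm.1.le).trans
      (mul_le_mul_of_nonneg_right hlt.le hb0n)
  have hDsplit : D = mass p B g 0 m + mass p B g m 1 :=
    hg.mass_add hB hp0.le zero_mem_unit hmI one_mem_unit
  have hkey := htest gt hgtT
  have hτp2 : τ ^ p ≤ τ * τ := by
    calc τ ^ p ≤ τ ^ (2:ℝ) := Real.rpow_le_rpow_of_exponent_ge hτ0 hτ1 hp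
      _ = τ * τ := by rw [Real.rpow_two, sq]
  have hq : 1 + τ / H ≤ 1 + 1 / H := by
    have : τ / H ≤ 1 / H := by gcongr
    linarith
  have hqpos : 0 < 1 + τ / H := by positivity
  have h7 : Λ * ((1 + τ / H) * (D - τ ^ p * D * b0)) ≤ C1 * τ ^ p * D + (Λ + δ) * D := by
    have h8 : (1 + τ / H) * (D - τ ^ p * D * b0) ≤ (1 + τ / H) * mass p B g m 1 :=
      mul_le_mul_of_nonneg_left (by linarith) hqpos.le
    have := mul_le_mul_of_nonneg_left (h8.trans hmass) hΛ.le
    linarith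
  have h9 : Λ * (1 + τ / H) * (1 - τ ^ p * b0) ≤ C1 * τ ^ p + (Λ + δ) := by
    refine le_of_mul_le_mul_right ?_ hDpos
    linarith
  have h10 : Λ * b0 * (1 + τ / H) * τ ^ p + C1 * τ ^ p ≤ E * (τ * τ) := by
    have h11 : Λ * b0 * (1 + τ / H) + C1 ≤ E := by
      rw [hE]
      have := mul_le_mul_of_nonneg_left hq (by positivity : 0 ≤ Λ * b0)
      linarith
    have : (Λ * b0 * (1 + τ / H) + C1) * τ ^ p ≤ E * (τ * τ) :=
      mul_le_mul h11 hτp2 hτp.le hEn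
    linarith
  have h12 : E * (τ * τ) ≤ Λ / (2 * H) * τ := by
    have := mul_le_mul_of_nonneg_right hτE hτ0.le
    linarith
  have h13 : Λ * (τ / H) ≤ δ + Λ / (2 * H) * τ := by linarith
  have h14 : Λ * (τ / H) = 4 * (Λ * τ / (4 * H)) := by field_simp
  have h15 : Λ / (2 * H) * τ = 2 * (Λ * τ / (4 * H)) := by field_simp; norm_num
  have h16 : 0 < Λ * τ / (4 * H) := by positivity
  linarith

/-- A local gain in the Rayleigh quotient forces a strict increase of the eigenvalue. -/
theorem exists_gap_of_transfer {p Λ CH m κ C : ℝ} {A B A' B' : ℝ → ℝ} (hp : 2 ≤ p)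
    (hA : BddMeas A) (hA0 : ∀ t ∈ Icc (0:ℝ) 1, 0 ≤ A t) (hB : BddMeas B)
    (hB0 : ∀ t ∈ Icc (0:ℝ) 1, 0 ≤ B t)
    (hΛ : 0 < Λ) (htest : ∀ g, TestDensity g → Λ * mass p B g 0 1 ≤ energy p A g 0 1)
    (hCH : 0 ≤ CH) (hH : ∀ g, TestDensity g → prim g 1 ^ p ≤ CH * energy p A g 0 1)
    (hm : m ∈ Ioo (0:ℝ) 1) (hκ : 0 < κ) (hC : 0 < C)
    (htr : ∀ g, TestDensity g → ∃ h, TestDensity h ∧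
      energy p A h 0 1 - Λ * mass p B h 0 1 + κ * prim h m ^ p ≤
        energy p A' g 0 1 - Λ * mass p B' g 0 1 ∧
      2 * Λ * mass p B' g 0 1 ≤ energy p A' g 0 1 + C * mass p B h 0 1) :
    ∃ ε > 0, ∀ g, TestDensity g → 0 < mass p B' g 0 1 →
      (Λ + ε) * mass p B' g 0 1 ≤ energy p A' g 0 1 := by
  obtain ⟨τ, hτ, δ, hδ, hS⟩ := exists_mass_le_prim hp hA hA0 hB hB0 hΛ htest hCH hH hm
  set M := 2 * C / Λ with hM
  have hMpos : 0 < M := by positivity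
  set ε := min (Λ / 2) (min (δ / M) (κ * τ / (2 * M))) with hε
  have hε0 : 0 < ε := by positivity
  have hε1 : ε ≤ Λ / 2 := min_le_left _ _
  have hε2 : ε * M ≤ δ := by
    rw [← le_div_iff₀ hMpos]; exact (min_le_right _ _).trans (min_le_left _ _)
  have hε3 : ε * M ≤ κ * τ / 2 := by
    rw [← le_div_iff₀ hMpos]
    refine ((min_le_right _ _).trans (min_le_right _ _)).trans (le_of_eq ?_)
    field_simp
  refine ⟨ε, hε0, fun g hg hD' => ?_⟩
  by_contra! hlt
  obtain ⟨h, hh, h1, h2⟩ := htr g hg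
  set D := mass p B h 0 1
  set D' := mass p B' g 0 1
  have h3 : D' ≤ M * D := by
    have : Λ / 2 * D' ≤ C * D := by nlinarith
    rw [hM, div_mul_eq_mul_div, le_div_iff₀ hΛ]; linarith
  have hDpos : 0 < D := by
    by_contra! hn
    nlinarith
  have hpr : 0 ≤ prim h m ^ p := Real.rpow_nonneg (hh.prim_nonneg ⟨hm.1.le, hm.2.le⟩) _
  have h4 : ε * D' ≤ ε * M * D := by
    have := mul_le_mul_of_nonneg_left h3 hε0.le
    linarith
  have h5 : energy p A h 0 1 ≤ (Λ + δ) * D := by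
    have := mul_le_mul_of_nonneg_right hε2 hDpos.le
    nlinarith
  have h6 := hS h hh h5
  have h7 := htest h hh
  have h8 : κ * prim h m ^ p ≤ ε * D' := by linarith
  have h9 := mul_le_mul_of_nonneg_left h6 hκ.le
  have h10 := mul_le_mul_of_nonneg_right hε3 hDpos.le
  have : 0 < κ * τ * D := by positivity
  linarith

theorem Fvol_nonneg {n : ℕ} {cn : ℝ} (hcn : 0 < cn) {z : ℝ × ℝ} (hz : z ∈ Pset) :
    0 ≤ Fvol n cn z :=
  mul_nonneg (mul_nonneg hcn.le (pow_nonneg hz.1 _)) (pow_nonneg hz.2 _)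

theorem MemRg.mem_Pset {x0 y0 : ℝ} {γ : ℝ → ℝ × ℝ} (hγ : MemRg x0 y0 γ) {t : ℝ}
    (ht : t ∈ Icc (0:ℝ) 1) : γ t ∈ Pset := by
  rcases ht.2.lt_or_eq with h | rfl
  · exact ⟨(hγ.2.2.2 t ⟨ht.1, h⟩).1.le, (hγ.2.2.2 t ⟨ht.1, h⟩).2.le⟩
  · exact hγ.2.2.1.1

theorem MemRg.continuousOn {x0 y0 : ℝ} {γ : ℝ → ℝ × ℝ} (hγ : MemRg x0 y0 γ) :
    ContinuousOn γ (Icc 0 1) := hγ.1.choose_spec.continuousOn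

theorem continuous_Fvol (n : ℕ) (cn : ℝ) : Continuous (Fvol n cn) := by
  unfold Fvol; fun_prop

/-- The set of Rayleigh quotients defining `lambdaG`. -/
def quotients (n : ℕ) (cn p : ℝ) (γ : ℝ → ℝ × ℝ) : Set ℝ :=
  {q | ∃ w : ℝ → ℝ, (∃ K, LipschitzOnWith K w (Icc 0 1)) ∧ w 0 = 0 ∧
    IntervalIntegrable (numG n cn p (Icc 0 1) γ w) volume 0 1 ∧
    IntervalIntegrable (denG n cn p (Icc 0 1) γ w) volume 0 1 ∧
    (0 < ∫ t in (0:ℝ)..1, denG n cn p (Icc 0 1) γ w t) ∧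
    q = (∫ t in (0:ℝ)..1, numG n cn p (Icc 0 1) γ w t) /
      (∫ t in (0:ℝ)..1, denG n cn p (Icc 0 1) γ w t)}

theorem gSpeedOn_nonneg (s : Set ℝ) (γ : ℝ → ℝ × ℝ) (t : ℝ) : 0 ≤ gSpeedOn s γ t :=
  Real.sqrt_nonneg _

theorem integral_numG_nonneg {n : ℕ} {cn p x0 y0 : ℝ} (hcn : 0 < cn) {γ : ℝ → ℝ × ℝ}
    (hγ : MemRg x0 y0 γ) (w : ℝ → ℝ) : 0 ≤ ∫ t in (0:ℝ)..1, numG n cn p (Icc 0 1) γ w t :=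
  intervalIntegral.integral_nonneg zero_le_one fun _ ht =>
    mul_nonneg (mul_nonneg (Real.rpow_nonneg (abs_nonneg _) _) (Fvol_nonneg hcn (hγ.mem_Pset ht)))
      (Real.rpow_nonneg (gSpeedOn_nonneg _ _ _) _)

theorem bddBelow_quotients {n : ℕ} {cn p x0 y0 : ℝ} (hcn : 0 < cn) {γ : ℝ → ℝ × ℝ}
    (hγ : MemRg x0 y0 γ) : BddBelow (quotients n cn p γ) := by
  refine ⟨0, ?_⟩
  rintro q ⟨w, -, -, -, -, h, rfl⟩
  exact div_nonneg (integral_numG_nonneg hcn hγ w) h.le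

/-- Weights `A`, `B` on `[0,1]` representing the Rayleigh quotient of a curve. -/
structure IsWeight (n : ℕ) (cn p : ℝ) (γ : ℝ → ℝ × ℝ) (A B : ℝ → ℝ) : Prop where
  measA : BddMeas A
  measB : BddMeas B
  nonnegA : ∀ t ∈ Icc (0:ℝ) 1, 0 ≤ A t
  nonnegB : ∀ t ∈ Icc (0:ℝ) 1, 0 ≤ B t
  eqA : ∀ᵐ t ∂(volume : Measure ℝ), t ∈ Icc (0:ℝ) 1 → Fvol n cn (γ t) * gSpeed γ t ^ (1 - p) = A t
  eqB : ∀ᵐ t ∂(volume : Measure ℝ), t ∈ Icc (0:ℝ) 1 → Fvol n cn (γ t) * gSpeed γ t = B t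

theorem ae_mem_Ioo_of_mem_Ioc :
    ∀ᵐ t ∂(volume : Measure ℝ), t ∈ Ioc (0:ℝ) 1 → t ∈ Ioo (0:ℝ) 1 := by
  have : ∀ᵐ t ∂(volume : Measure ℝ), t ≠ 1 := by simp [ae_iff]
  filter_upwards [this] with t h1 ht
  exact ⟨ht.1, lt_of_le_of_ne ht.2 h1⟩

namespace IsWeight

variable {n : ℕ} {cn p : ℝ} {γ : ℝ → ℝ × ℝ} {A B : ℝ → ℝ}

theorem div_mem_quotients (hw : IsWeight n cn p γ A B) (hp : 0 ≤ p) {g : ℝ → ℝ}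
    (hg : TestDensity g) (hpos : 0 < mass p B g 0 1) :
    energy p A g 0 1 / mass p B g 0 1 ∈ quotients n cn p γ := by
  have hderiv : ∀ᵐ t ∂(volume : Measure ℝ), t ∈ Ioc (0:ℝ) 1 →
      derivWithin (prim g) (Icc 0 1) t = g t := by
    have h := (hg.meas.intervalIntegrable zero_mem_unit one_mem_unit).ae_hasDerivAt_integral
    filter_upwards [h, ae_mem_Ioo_of_mem_Ioc] with t h1 h2 ht
    have h3 := h1 (by rw [uIcc_of_le zero_le_one]; exact ⟨ht.1.le, ht.2⟩) 0 (by simp)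
    exact h3.hasDerivWithinAt.derivWithin
      (uniqueDiffOn_Icc zero_lt_one t ⟨ht.1.le, ht.2⟩)
  have hnum : ∀ᵐ t ∂(volume : Measure ℝ), t ∈ Ioc (0:ℝ) 1 →
      numG n cn p (Icc 0 1) γ (prim g) t = g t ^ p * A t := by
    filter_upwards [hderiv, hw.eqA] with t h1 h2 ht
    rw [numG, h1 ht, abs_of_nonneg (hg.nonneg t ⟨ht.1.le, ht.2⟩), ← h2 ⟨ht.1.le, ht.2⟩, mul_assoc]
    rfl
  have hden : ∀ᵐ t ∂(volume : Measure ℝ), t ∈ Ioc (0:ℝ) 1 →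
      denG n cn p (Icc 0 1) γ (prim g) t = prim g t ^ p * B t := by
    filter_upwards [hw.eqB] with t h2 ht
    rw [denG, abs_of_nonneg (hg.prim_nonneg ⟨ht.1.le, ht.2⟩), ← h2 ⟨ht.1.le, ht.2⟩, mul_assoc]
    rfl
  have hun : uIoc (0:ℝ) 1 = Ioc 0 1 := uIoc_of_le zero_le_one
  have e1 : ∫ t in (0:ℝ)..1, numG n cn p (Icc 0 1) γ (prim g) t = energy p A g 0 1 :=
    intervalIntegral.integral_congr_ae (by rw [hun]; exact hnum)
  have e2 : ∫ t in (0:ℝ)..1, denG n cn p (Icc 0 1) γ (prim g) t = mass p B g 0 1 :=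
    intervalIntegral.integral_congr_ae (by rw [hun]; exact hden)
  refine ⟨prim g, ?_, by simp [prim], ?_, ?_, by rwa [e2], by rw [e1, e2]⟩
  · obtain ⟨K, hK⟩ := hg.meas.2
    have hK0 : 0 ≤ K := (abs_nonneg _).trans (hK 0 zero_mem_unit)
    refine ⟨⟨K, hK0⟩, LipschitzOnWith.of_dist_le_mul fun t ht s hs => ?_⟩
    rw [Real.dist_eq, Real.dist_eq, hg.prim_sub hs ht, add_sub_cancel_left]
    exact intervalIntegral.norm_integral_le_of_norm_le_const (C := K) (f := g) fun r hr =>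
      hK r (uIcc_subset_Icc hs ht (uIoc_subset_uIcc hr))
  · refine ((hg.energy_bddMeas hw.measA hp).intervalIntegrable zero_mem_unit
      one_mem_unit).congr_ae ?_
    rw [hun, EventuallyEq, ae_restrict_iff' measurableSet_Ioc]
    filter_upwards [hnum] with t h ht using (h ht).symm
  · refine ((hg.mass_bddMeas hw.measB hp).intervalIntegrable zero_mem_unit
      one_mem_unit).congr_ae ?_
    rw [hun, EventuallyEq, ae_restrict_iff' measurableSet_Ioc]
    filter_upwards [hden] with t h ht using (h ht).symm

theorem lambdaG_mul_mass_le (hw : IsWeight n cn p γ A B) (hp : 0 ≤ p) (hcn : 0 < cn) {x0 y0 : ℝ}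
    (hγ : MemRg x0 y0 γ) {g : ℝ → ℝ} (hg : TestDensity g) :
    lambdaG n cn p γ * mass p B g 0 1 ≤ energy p A g 0 1 := by
  rcases (hg.mass_nonneg hw.nonnegB (p := p) zero_mem_unit one_mem_unit zero_le_one).eq_or_lt
    with h | h
  · rw [← h, mul_zero]
    exact hg.energy_nonneg hw.nonnegA zero_mem_unit one_mem_unit zero_le_one
  · rw [← le_div_iff₀ h]
    exact csInf_le (bddBelow_quotients hcn hγ) (hw.div_mem_quotients hp hg h)

theorem le_lambdaG (hw : IsWeight n cn p γ A B) (hp : 0 ≤ p) {μ : ℝ} {g₀ : ℝ → ℝ}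
    (hg₀ : TestDensity g₀) (hpos : 0 < mass p B g₀ 0 1)
    (h : ∀ g, TestDensity g → 0 < mass p B g 0 1 → μ * mass p B g 0 1 ≤ energy p A g 0 1) :
    μ ≤ lambdaG n cn p γ := by
  refine le_csInf ⟨_, hw.div_mem_quotients hp hg₀ hpos⟩ ?_
  rintro q ⟨w, ⟨K, hK⟩, hw0, hnumI, hdenI, hden0, rfl⟩
  set g : ℝ → ℝ := fun t => if t ∈ Ioo (0:ℝ) 1 then |deriv w t| else 0 with hgdef
  have hdw : ∀ t ∈ Ioo (0:ℝ) 1, derivWithin w (Icc 0 1) t = deriv w t := fun t ht =>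
    derivWithin_of_mem_nhds (Icc_mem_nhds ht.1 ht.2)
  have hbd : ∀ t ∈ Ioo (0:ℝ) 1, |deriv w t| ≤ K := fun t ht =>
    norm_deriv_le_of_lipschitzOn (Icc_mem_nhds ht.1 ht.2) hK
  have hgT : TestDensity g := by
    refine ⟨⟨?_, K, fun t ht => ?_⟩, fun t ht => ?_⟩
    · have : g = (Ioo (0:ℝ) 1).indicator fun t => |deriv w t| := by
        ext t; simp [hgdef, indicator]
      rw [this]
      exact (((measurable_deriv w).abs).indicator measurableSet_Ioo).aestronglyMeasurable
    · simp only [hgdef]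
      split_ifs with h
      · rw [abs_abs]; exact hbd t h
      · simp
    · simp only [hgdef]
      split_ifs with h
      · exact abs_nonneg _
      · exact le_rfl
  have hle : ∀ t ∈ Icc (0:ℝ) 1, |w t| ≤ prim g t := by
    intro t ht
    have hac : AbsolutelyContinuousOnInterval w 0 t :=
      (hK.mono (by rw [uIcc_of_le ht.1]; exact Icc_subset_Icc_right ht.2)
        ).absolutelyContinuousOnInterval
    have h1 := hac.integral_deriv_eq_sub
    rw [hw0, sub_zero] at h1
    rw [← h1]
    refine (intervalIntegral.abs_integral_le_integral_abs ht.1).trans (le_of_eq ?_)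
    exact integral_congr_Ioo ht.1 fun s hs => (if_pos ⟨hs.1, hs.2.trans_le ht.2⟩).symm
  have hun : uIoc (0:ℝ) 1 = Ioc 0 1 := uIoc_of_le zero_le_one
  have e1 : ∫ t in (0:ℝ)..1, numG n cn p (Icc 0 1) γ w t = energy p A g 0 1 := by
    refine intervalIntegral.integral_congr_ae ?_
    rw [hun]
    filter_upwards [hw.eqA, ae_mem_Ioo_of_mem_Ioc] with t h1 h2 ht
    rw [numG, hdw t (h2 ht), ← h1 ⟨ht.1.le, ht.2⟩, mul_assoc]
    simp only [hgdef, if_pos (h2 ht)]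
    rfl
  have e2 : ∫ t in (0:ℝ)..1, denG n cn p (Icc 0 1) γ w t ≤ mass p B g 0 1 := by
    refine intervalIntegral.integral_mono_ae_restrict zero_le_one hdenI
      ((hgT.mass_bddMeas hw.measB hp).intervalIntegrable zero_mem_unit one_mem_unit) ?_
    rw [EventuallyLE, ae_restrict_iff' measurableSet_Icc]
    filter_upwards [hw.eqB] with t h1 ht
    rw [denG, mul_assoc]
    change |w t| ^ p * (Fvol n cn (γ t) * gSpeed γ t) ≤ _
    rw [h1 ht]
    exact mul_le_mul_of_nonneg_right (Real.rpow_le_rpow (abs_nonneg _) (hle t ht) hp)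
      (hw.nonnegB t ht)
  have hm := hden0.trans_le e2
  rw [e1]
  refine ((le_div_iff₀ hm).2 (h g hgT hm)).trans ?_
  exact div_le_div_of_nonneg_left
    (hgT.energy_nonneg hw.nonnegA zero_mem_unit one_mem_unit zero_le_one) hden0 e2

end IsWeight

/-- If every test function on `γ` can be transferred to one on the maximizer `α` with a definite
gain, then `γ` has a larger eigenvalue, a contradiction. -/
theorem not_transfer {n : ℕ} {cn p CH m κ C x0 y0 : ℝ} {α γ : ℝ → ℝ × ℝ}
    {A B A' B' : ℝ → ℝ} (hcn : 0 < cn) (hp : 2 ≤ p) (hα : MemRg x0 y0 α)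
    (hmax : lambdaG n cn p γ ≤ lambdaG n cn p α) (hw : IsWeight n cn p α A B)
    (hw' : IsWeight n cn p γ A' B') (hpos : 0 < lambdaG n cn p α)
    {g₀ : ℝ → ℝ} (hg₀ : TestDensity g₀) (hg₀pos : 0 < mass p B' g₀ 0 1)
    (hCH : 0 ≤ CH) (hH : ∀ g, TestDensity g → prim g 1 ^ p ≤ CH * energy p A g 0 1)
    (hm : m ∈ Ioo (0:ℝ) 1) (hκ : 0 < κ) (hC : 0 < C)
    (htr : ∀ g, TestDensity g → ∃ h, TestDensity h ∧
      energy p A h 0 1 - lambdaG n cn p α * mass p B h 0 1 + κ * prim h m ^ p ≤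
        energy p A' g 0 1 - lambdaG n cn p α * mass p B' g 0 1 ∧
      2 * lambdaG n cn p α * mass p B' g 0 1 ≤ energy p A' g 0 1 + C * mass p B h 0 1) :
    False := by
  have hp0 : 0 ≤ p := by linarith
  obtain ⟨ε, hε, h⟩ := exists_gap_of_transfer hp hw.measA hw.nonnegA hw.measB hw.nonnegB hpos
    (fun g hg => hw.lambdaG_mul_mass_le hp0 hcn hα hg) hCH hH hm hκ hC htr
  have := hw'.le_lambdaG hp0 hg₀ hg₀pos h
  linarith

/-- A plane curve, viewed as a curve in the complex plane (with its Euclidean norm). -/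
def cx (α : ℝ → ℝ × ℝ) (t : ℝ) : ℂ := ⟨(α t).1, (α t).2⟩

theorem norm_cx_sub_sq (α : ℝ → ℝ × ℝ) (s t : ℝ) :
    ‖cx α t - cx α s‖ ^ 2 = ((α t).1 - (α s).1) ^ 2 + ((α t).2 - (α s).2) ^ 2 := by
  rw [Complex.sq_norm, Complex.normSq_apply]
  simp [cx]
  ring

theorem abs_fst_sub_le (α : ℝ → ℝ × ℝ) (s t : ℝ) :
    |(α t).1 - (α s).1| ≤ ‖cx α t - cx α s‖ := by
  simpa [cx] using Complex.abs_re_le_norm (cx α t - cx α s)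

theorem abs_snd_sub_le (α : ℝ → ℝ × ℝ) (s t : ℝ) :
    |(α t).2 - (α s).2| ≤ ‖cx α t - cx α s‖ := by
  simpa [cx] using Complex.abs_im_le_norm (cx α t - cx α s)

theorem sq_gSpeedOn (s : Set ℝ) (α : ℝ → ℝ × ℝ) (t : ℝ) :
    gSpeedOn s α t ^ 2 = (derivWithin (fun u => (α u).1) s t) ^ 2 +
      (derivWithin (fun u => (α u).2) s t) ^ 2 :=
  Real.sq_sqrt (by positivity)

/-- A Lipschitz curve with speed at most `L` almost everywhere is `L`-Lipschitz. -/
theorem norm_cx_sub_le {α : ℝ → ℝ × ℝ} {K : NNReal} (hK : LipschitzOnWith K α (Icc 0 1)) {L : ℝ}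
    (hL0 : 0 ≤ L) (hL : ∀ᵐ t ∂(volume : Measure ℝ), t ∈ Icc (0:ℝ) 1 → gSpeed α t ≤ L) {s t : ℝ}
    (hs : s ∈ Icc (0:ℝ) 1) (ht : t ∈ Icc (0:ℝ) 1) (hst : s ≤ t) :
    ‖cx α t - cx α s‖ ≤ L * (t - s) := by
  have hsub : Icc s t ⊆ Icc (0:ℝ) 1 := Icc_subset_Icc hs.1 ht.2
  have hac1 : AbsolutelyContinuousOnInterval (fun u => (α u).1) s t :=
    ((LipschitzWith.prod_fst.lipschitzOnWith (s := univ)).comp hK (fun _ _ => mem_univ _)).mono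
      (by rwa [uIcc_of_le hst]) |>.absolutelyContinuousOnInterval
  have hac2 : AbsolutelyContinuousOnInterval (fun u => (α u).2) s t :=
    ((LipschitzWith.prod_snd.lipschitzOnWith (s := univ)).comp hK (fun _ _ => mem_univ _)).mono
      (by rwa [uIcc_of_le hst]) |>.absolutelyContinuousOnInterval
  have e1 := hac1.integral_deriv_eq_sub
  have e2 := hac2.integral_deriv_eq_sub
  set d := ‖cx α t - cx α s‖ with hd
  set a := (α t).1 - (α s).1 with ha
  set b := (α t).2 - (α s).2 with hb
  have hd2 : d ^ 2 = a ^ 2 + b ^ 2 := norm_cx_sub_sq α s t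
  have hd0 : 0 ≤ d := norm_nonneg _
  have key : a * a + b * b ≤ d * L * (t - s) := by
    calc a * a + b * b = ∫ u in s..t, (a * deriv (fun u => (α u).1) u +
          b * deriv (fun u => (α u).2) u) := by
            rw [intervalIntegral.integral_add (hac1.intervalIntegrable_deriv.const_mul _)
              (hac2.intervalIntegrable_deriv.const_mul _), intervalIntegral.integral_const_mul,
              intervalIntegral.integral_const_mul, e1, e2]
      _ ≤ ∫ u in s..t, d * L := by
            refine intervalIntegral.integral_mono_ae_restrict hst
              ((hac1.intervalIntegrable_deriv.const_mul _).add
              (hac2.intervalIntegrable_deriv.const_mul _)) (by simp) ?_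
            rw [EventuallyLE, ae_restrict_iff' measurableSet_Icc]
            have h0 : ∀ᵐ u ∂(volume : Measure ℝ), u ≠ s := by simp [ae_iff]
            have h1 : ∀ᵐ u ∂(volume : Measure ℝ), u ≠ t := by simp [ae_iff]
            filter_upwards [hL, h0, h1] with u hu hus hut hI
            have hmem : Icc (0:ℝ) 1 ∈ 𝓝 u := mem_of_superset
              (Ioo_mem_nhds (lt_of_le_of_ne hI.1 (Ne.symm hus)) (lt_of_le_of_ne hI.2 hut))
              (Ioo_subset_Icc_self.trans hsub)
            have hsp := sq_gSpeedOn (Icc 0 1) α u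
            rw [derivWithin_of_mem_nhds hmem, derivWithin_of_mem_nhds hmem] at hsp
            have hg := hu (hsub hI)
            have hg0 := gSpeedOn_nonneg (Icc 0 1) α u
            refine le_trans (le_of_abs_le (abs_le_of_sq_le_sq ?_ (mul_nonneg hd0 hg0)))
              (mul_le_mul_of_nonneg_left hg hd0)
            rw [mul_pow, hsp, hd2]
            nlinarith [sq_nonneg (a * deriv (fun u => (α u).2) u - b * deriv (fun u => (α u).1) u)]
      _ = d * L * (t - s) := by simp; ring
  rcases hd0.eq_or_lt with h | h
  · rw [← h]; exact mul_nonneg hL0 (by linarith)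
  · have : d * d ≤ d * (L * (t - s)) := by nlinarith
    exact le_of_mul_le_mul_left this h

theorem Lg_nonneg (α : ℝ → ℝ × ℝ) : 0 ≤ Lg α :=
  intervalIntegral.integral_nonneg zero_le_one fun t _ => gSpeedOn_nonneg _ α t

/-- The quantitative data carried by a curve of class `R_g^*`. -/
structure StarData (x0 y0 : ℝ) (α : ℝ → ℝ × ℝ) (L c M : ℝ) : Prop where
  mem : MemRg x0 y0 α
  inj : InjOn α (Icc 0 1)
  speed : ∀ᵐ t ∂(volume : Measure ℝ), t ∈ Icc (0:ℝ) 1 → gSpeed α t = L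
  L_pos : 0 < L
  c_pos : 0 < c
  M_pos : 0 < M
  le_v : ∀ t ∈ Icc (0:ℝ) 1, c * (1 - t) ≤ (α t).1 * (α t).2
  dist_le : ∀ s ∈ Icc (0:ℝ) 1, ∀ t ∈ Icc (0:ℝ) 1, s ≤ t → ‖cx α t - cx α s‖ ≤ L * (t - s)
  fst_le : ∀ t ∈ Icc (0:ℝ) 1, (α t).1 ≤ M
  snd_le : ∀ t ∈ Icc (0:ℝ) 1, (α t).2 ≤ M
  snd_one : (α 1).2 = 0
  fst_one : 0 < (α 1).1

theorem MemRgStar.exists_starData {x0 y0 : ℝ} {α : ℝ → ℝ × ℝ}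
    (hα : MemRgStar x0 y0 α) : ∃ c M, StarData x0 y0 α (Lg α) c M := by
  obtain ⟨hm, hinj, hsp, hu, c, hc, hv⟩ := hα
  obtain ⟨K, hK⟩ := hm.1
  have hdist : ∀ s ∈ Icc (0:ℝ) 1, ∀ t ∈ Icc (0:ℝ) 1, s ≤ t →
      ‖cx α t - cx α s‖ ≤ Lg α * (t - s) := fun s hs t ht hst =>
    norm_cx_sub_le hK (Lg_nonneg α) (hsp.mono fun t h ht => (h ht).le) hs ht hst
  have h1 := hm.2.2.1
  have hfst : (α 1).1 ≠ 0 := by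
    intro h
    rw [ucoord, h] at hu
    nlinarith [sq_nonneg (α 1).2]
  have hpos : 0 < Lg α := by
    refine (Lg_nonneg α).lt_of_ne fun h => ?_
    have h01 := hdist 0 zero_mem_unit 1 one_mem_unit zero_le_one
    rw [← h, zero_mul] at h01
    have h2 := (abs_snd_sub_le α 0 1).trans h01
    have h3 := (abs_fst_sub_le α 0 1).trans h01
    have h4 := hm.2.2.2 0 ⟨le_rfl, zero_lt_one⟩
    have e2 := abs_nonpos_iff.1 h2
    rcases h1.2 with h5 | h5
    · exact hfst h5
    · have := h4.2
      linarith
  obtain ⟨M, hM⟩ := isCompact_Icc.exists_bound_of_continuousOn hm.continuousOn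
  refine ⟨c, max M 1, hm, hinj, hsp, hpos, hc, by positivity, hv, hdist, fun t ht => ?_,
    fun t ht => ?_, h1.2.resolve_left hfst, lt_of_le_of_ne h1.1.1 (Ne.symm hfst)⟩
  · exact (le_abs_self _).trans (((norm_fst_le _).trans (hM t ht)).trans (le_max_left _ _))
  · exact (le_abs_self _).trans (((norm_snd_le _).trans (hM t ht)).trans (le_max_left _ _))

namespace StarData

variable {x0 y0 L c M : ℝ} {α : ℝ → ℝ × ℝ}

theorem fst_nonneg (h : StarData x0 y0 α L c M) {t : ℝ} (ht : t ∈ Icc (0:ℝ) 1) : 0 ≤ (α t).1 :=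
  (h.mem.mem_Pset ht).1

theorem snd_nonneg (h : StarData x0 y0 α L c M) {t : ℝ} (ht : t ∈ Icc (0:ℝ) 1) : 0 ≤ (α t).2 :=
  (h.mem.mem_Pset ht).2

theorem isWeight (h : StarData x0 y0 α L c M) {n : ℕ} {cn p : ℝ} (hcn : 0 < cn) :
    IsWeight n cn p α (fun t => Fvol n cn (α t) * L ^ (1 - p)) (fun t => Fvol n cn (α t) * L) := by
  have hF : BddMeas fun t => Fvol n cn (α t) := .of_continuousOn
    ((continuous_Fvol n cn).comp_continuousOn h.mem.continuousOn)
  have hF0 : ∀ t ∈ Icc (0:ℝ) 1, 0 ≤ Fvol n cn (α t) := fun t ht =>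
    Fvol_nonneg hcn (h.mem.mem_Pset ht)
  exact ⟨hF.mul (.const _), hF.mul (.const _),
    fun t ht => mul_nonneg (hF0 t ht) (Real.rpow_nonneg h.L_pos.le _),
    fun t ht => mul_nonneg (hF0 t ht) h.L_pos.le,
    h.speed.mono fun t hs ht => by rw [hs ht], h.speed.mono fun t hs ht => by rw [hs ht]⟩

theorem le_Fvol (h : StarData x0 y0 α L c M) {n : ℕ} {cn : ℝ} (hcn : 0 < cn) {t : ℝ}
    (ht : t ∈ Icc (0:ℝ) 1) : cn * c ^ (n - 1) * (1 - t) ^ (n - 1) ≤ Fvol n cn (α t) := by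
  rw [Fvol, mul_assoc, mul_assoc, ← mul_pow, ← mul_pow]
  exact mul_le_mul_of_nonneg_left (pow_le_pow_left₀
    (mul_nonneg h.c_pos.le (by linarith [ht.2])) (h.le_v t ht) _) hcn.le

/-- The Hardy-type bound along the curve. -/
theorem exists_hardy (h : StarData x0 y0 α L c M) {n : ℕ} (hn : 2 ≤ n) {cn p : ℝ} (hcn : 0 < cn)
    (hp : 2 * (n : ℝ) - 1 ≤ p) : ∃ CH > 0, ∀ g, TestDensity g →
      prim g 1 ^ p ≤ CH * energy p (fun t => Fvol n cn (α t) * L ^ (1 - p)) g 0 1 := by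
  have hc := h.c_pos
  have hL := h.L_pos
  have hk : 0 < cn * c ^ (n - 1) * L ^ (1 - p) := by positivity
  refine ⟨2 ^ (p - 1) / (cn * c ^ (n - 1) * L ^ (1 - p)), by positivity, fun g hg => ?_⟩
  have := hg.rpow_integral_le (h.isWeight hcn (p := p)).measA hn hp zero_mem_unit hk
    fun t ht => by
      have := mul_le_mul_of_nonneg_right (h.le_Fvol (n := n) hcn ⟨ht.1.le, ht.2.le⟩)
        (Real.rpow_nonneg hL.le (1 - p))
      calc _ = _ := by ring
        _ ≤ _ := this
  rw [div_mul_eq_mul_div, le_div_iff₀ hk, mul_comm]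
  exact this

theorem Fvol_pos (h : StarData x0 y0 α L c M) {n : ℕ} {cn : ℝ} (hcn : 0 < cn) {t : ℝ}
    (ht : t ∈ Ico (0:ℝ) 1) : 0 < Fvol n cn (α t) := by
  have := h.mem.2.2.2 t ht
  exact mul_pos (mul_pos hcn (pow_pos this.1 _)) (pow_pos this.2 _)

end StarData

/-- The mass of the identity-like test density is positive for a.e. positive weights. -/
theorem mass_const_pos {p : ℝ} (hp : 0 ≤ p) {B : ℝ → ℝ} (hB : BddMeas B)
    (hpos : ∀ t ∈ Ioo (0:ℝ) 1, 0 < B t) :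
    0 < mass p B (fun _ => 1) 0 1 := by
  have hg : TestDensity fun _ => (1:ℝ) := .const zero_le_one
  have := intervalIntegral.intervalIntegral_pos_of_pos_on
    ((hg.mass_bddMeas hB hp).intervalIntegrable zero_mem_unit one_mem_unit) (fun t ht => ?_)
    zero_lt_one
  · exact this
  · have : prim (fun _ => 1) t = t := by simp [prim]
    rw [this]
    exact mul_pos (Real.rpow_pos_of_pos ht.1 _) (hpos t ht)

theorem StarData.lambdaG_pos {x0 y0 L c M : ℝ} {α : ℝ → ℝ × ℝ} (h : StarData x0 y0 α L c M)
    {n : ℕ} (hn : 2 ≤ n) {cn p : ℝ} (hcn : 0 < cn) (hp : 2 * (n : ℝ) - 1 ≤ p) :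
    0 < lambdaG n cn p α := by
  have hn' : (2:ℝ) ≤ n := by exact_mod_cast hn
  have hp0 : 0 ≤ p := by linarith
  obtain ⟨CH, hCH, hH⟩ := h.exists_hardy hn hcn hp
  have hw := h.isWeight (n := n) (p := p) hcn
  set B := fun t => Fvol n cn (α t) * L
  have hBpos : ∀ t ∈ Ioo (0:ℝ) 1, 0 < B t := fun t ht =>
    mul_pos (h.Fvol_pos hcn ⟨ht.1.le, ht.2⟩) h.L_pos
  have hI : 0 < ∫ t in (0:ℝ)..1, B t := intervalIntegral.intervalIntegral_pos_of_pos_on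
    (hw.measB.intervalIntegrable zero_mem_unit one_mem_unit) hBpos zero_lt_one
  have hd : 0 < CH * ∫ t in (0:ℝ)..1, B t := mul_pos hCH hI
  refine lt_of_lt_of_le (inv_pos.2 hd)
    (hw.le_lambdaG hp0 (.const zero_le_one) (mass_const_pos hp0 hw.measB hBpos)
      fun g hg _ => ?_)
  rw [inv_mul_le_iff₀ hd]
  calc mass p B g 0 1 ≤ prim g 1 ^ p * ∫ t in (0:ℝ)..1, B t :=
        hg.mass_le hw.measB hw.nonnegB hp0 zero_mem_unit one_mem_unit zero_le_one
    _ ≤ _ := by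
        have := mul_le_mul_of_nonneg_right (hH g hg) hI.le
        linarith

/-- The affine segment on `[s,t]` from `a` to `z`. -/
def seg (s t : ℝ) (a z : ℝ × ℝ) (τ : ℝ) : ℝ × ℝ :=
  (a.1 + (τ - s) / (t - s) * (z.1 - a.1), a.2 + (τ - s) / (t - s) * (z.2 - a.2))

/-- The curve `α` with its arc over `(s,t]` replaced by a segment ending at `z`. -/
def splice (α : ℝ → ℝ × ℝ) (s t : ℝ) (z : ℝ × ℝ) (τ : ℝ) : ℝ × ℝ :=
  if τ ≤ s then α τ else if τ ≤ t then seg s t (α s) z τ else α τ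

/-- A weight which agrees with `A` off `(s,t]` and with `D` on `(s,t]`. -/
def spliceWeight (A D : ℝ → ℝ) (s t τ : ℝ) : ℝ :=
  if τ ≤ s then A τ else if τ ≤ t then D τ else A τ

section seg

variable {s t τ : ℝ} {a z : ℝ × ℝ}

theorem seg_left : seg s t a z s = a := by simp [seg]

theorem seg_right (h : s < t) : seg s t a z t = z := by
  have : t - s ≠ 0 := by linarith
  simp [seg, this]

theorem seg_mem_Pset (h : s < t) (hτ : τ ∈ Icc s t) (ha : a ∈ Pset) (hz : z ∈ Pset) :
    seg s t a z τ ∈ Pset := by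
  have h0 : 0 ≤ (τ - s) / (t - s) := div_nonneg (by linarith [hτ.1]) (by linarith)
  have h1 : (τ - s) / (t - s) ≤ 1 := (div_le_one (by linarith)).2 (by linarith [hτ.2])
  simp only [Pset, mem_ofPred_eq, seg] at *
  constructor
  · nlinarith [mul_nonneg h0 hz.1, mul_nonneg (sub_nonneg.2 h1) ha.1]
  · nlinarith [mul_nonneg h0 hz.2, mul_nonneg (sub_nonneg.2 h1) ha.2]

theorem seg_mem_Pint (h : s < t) (hτ : τ ∈ Ico s t) (ha : a ∈ Pint) (hz : z ∈ Pset) :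
    seg s t a z τ ∈ Pint := by
  have h0 : 0 ≤ (τ - s) / (t - s) := div_nonneg (by linarith [hτ.1]) (by linarith)
  have h1 : (τ - s) / (t - s) < 1 := (div_lt_one (by linarith)).2 (by linarith [hτ.2])
  simp only [Pset, Pint, mem_ofPred_eq, seg] at *
  constructor
  · nlinarith [mul_nonneg h0 hz.1, mul_pos (sub_pos.2 h1) ha.1]
  · nlinarith [mul_nonneg h0 hz.2, mul_pos (sub_pos.2 h1) ha.2]

theorem continuous_seg : Continuous (seg s t a z) := by unfold seg; fun_prop

theorem gSpeed_seg (hτ : τ ∈ Ioo (0:ℝ) 1) :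
    gSpeed (seg s t a z) τ = √((z.1 - a.1) ^ 2 + (z.2 - a.2) ^ 2) / |t - s| := by
  have hmem : Icc (0:ℝ) 1 ∈ 𝓝 τ := Icc_mem_nhds hτ.1 hτ.2
  have key : ∀ b c : ℝ, derivWithin (fun u => b + (u - s) / (t - s) * c) (Icc 0 1) τ =
      1 / (t - s) * c := fun b c => by
    rw [derivWithin_of_mem_nhds hmem]
    exact (((((hasDerivAt_id τ).sub_const s).div_const (t - s)).mul_const c).const_add b).deriv
  simp only [gSpeed, gSpeedOn, seg, key]
  rw [← Real.sqrt_sq (abs_nonneg (t - s)), ← Real.sqrt_div (by positivity), sq_abs]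
  congr 1
  by_cases h : t - s = 0
  · simp [h]
  · field_simp

end seg

theorem lipschitzOnWith_Icc_union {E : Type*} [PseudoMetricSpace E] {f : ℝ → E} {a b c : ℝ}
    {K₁ K₂ : NNReal} (h₁ : LipschitzOnWith K₁ f (Icc a b)) (h₂ : LipschitzOnWith K₂ f (Icc b c)) :
    LipschitzOnWith (max K₁ K₂) f (Icc a c) := by
  have k₁ : (K₁ : ℝ) ≤ (max K₁ K₂ : NNReal) := by exact_mod_cast le_max_left _ _
  have k₂ : (K₂ : ℝ) ≤ (max K₁ K₂ : NNReal) := by exact_mod_cast le_max_right _ _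
  have main : ∀ x ∈ Icc a c, ∀ y ∈ Icc a c, x ≤ y →
      dist (f x) (f y) ≤ (max K₁ K₂ : NNReal) * dist x y := by
    intro x hx y hy hxy
    have hd : dist x y = y - x := by rw [Real.dist_eq, abs_sub_comm, abs_of_nonneg (by linarith)]
    rcases le_total y b with h | h
    · exact (h₁.dist_le_mul x ⟨hx.1, hxy.trans h⟩ y ⟨hy.1, h⟩).trans
        (mul_le_mul_of_nonneg_right k₁ dist_nonneg)
    rcases le_total b x with h' | h'
    · exact (h₂.dist_le_mul x ⟨h', hx.2⟩ y ⟨h, hy.2⟩).trans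
        (mul_le_mul_of_nonneg_right k₂ dist_nonneg)
    · have e₁ := h₁.dist_le_mul x ⟨hx.1, h'⟩ b ⟨hx.1.trans h', le_rfl⟩
      have e₂ := h₂.dist_le_mul b ⟨le_rfl, h.trans hy.2⟩ y ⟨h, hy.2⟩
      rw [Real.dist_eq, abs_sub_comm, abs_of_nonneg (by linarith)] at e₁ e₂
      have := dist_triangle (f x) (f b) (f y)
      rw [hd]
      nlinarith [mul_le_mul_of_nonneg_right k₁ (sub_nonneg.2 h'),
        mul_le_mul_of_nonneg_right k₂ (sub_nonneg.2 h)]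
  refine LipschitzOnWith.of_dist_le_mul fun x hx y hy => ?_
  rcases le_total x y with h | h
  · exact main x hx y hy h
  · rw [dist_comm (f x), dist_comm x]
    exact main y hy x hx h

theorem LipschitzOnWith.congr_eqOn {E : Type*} [PseudoMetricSpace E] {f g : ℝ → E} {S : Set ℝ}
    {K : NNReal} (h : LipschitzOnWith K f S) (hg : ∀ τ ∈ S, g τ = f τ) : LipschitzOnWith K g S :=
  fun x hx y hy => by rw [hg x hx, hg y hy]; exact h hx hy

namespace StarData

variable {x0 y0 L c M s t : ℝ} {α : ℝ → ℝ × ℝ} {z : ℝ × ℝ}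

theorem splice_memRg (h : StarData x0 y0 α L c M) (hs : 0 ≤ s) (hst : s < t) (ht : t ≤ 1)
    (hz : z = α t ∨ t = 1 ∧ z ∈ Pbdry) : MemRg x0 y0 (splice α s t z) := by
  have hsI : s ∈ Ico (0:ℝ) 1 := ⟨hs, hst.trans_le ht⟩
  have htI : t ∈ Icc (0:ℝ) 1 := ⟨hs.trans hst.le, ht⟩
  have hzP : z ∈ Pset := by
    rcases hz with rfl | ⟨-, hz⟩
    · exact h.mem.mem_Pset htI
    · exact hz.1
  have e1 : ∀ τ ∈ Icc 0 s, splice α s t z τ = α τ := fun τ hτ => if_pos hτ.2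
  have e2 : ∀ τ ∈ Icc s t, splice α s t z τ = seg s t (α s) z τ := fun τ hτ => by
    rcases hτ.1.eq_or_lt with rfl | h'
    · rw [splice, if_pos le_rfl, seg_left]
    · rw [splice, if_neg (not_le.2 h'), if_pos hτ.2]
  have e3 : t < 1 ∨ z = α t → ∀ τ ∈ Icc t 1, splice α s t z τ = α τ := fun hor τ hτ => by
    have hz' : z = α t := by
      rcases hor with h' | h'
      · exact hz.resolve_right fun h'' => h'.ne h''.1
      · exact h'
    rcases hτ.1.eq_or_lt with rfl | h'
    · rw [e2 _ ⟨hst.le, le_rfl⟩, seg_right hst, hz']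
    · rw [splice, if_neg (not_le.2 (hst.trans h')), if_neg (not_le.2 h')]
  obtain ⟨K, hK⟩ := h.mem.1
  refine ⟨?_, ?_, ?_, ?_⟩
  · have l1 : LipschitzOnWith K (splice α s t z) (Icc 0 s) :=
      (hK.mono (Icc_subset_Icc_right hsI.2.le)).congr_eqOn e1
    have l2 : ∃ K', LipschitzOnWith K' (splice α s t z) (Icc s t) := by
      have : ContDiff ℝ 1 (seg s t (α s) z) := by unfold seg; fun_prop
      obtain ⟨K', hK'⟩ := this.contDiffOn.exists_lipschitzOnWith one_ne_zero
        (convex_Icc s t) isCompact_Icc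
      exact ⟨K', hK'.congr_eqOn e2⟩
    have l3 : LipschitzOnWith K (splice α s t z) (Icc t 1) := by
      rcases ht.lt_or_eq with h' | h'
      · exact (hK.mono (Icc_subset_Icc_left htI.1)).congr_eqOn (e3 (Or.inl h'))
      · rw [h', Icc_self]
        intro x hx y hy
        rw [mem_singleton_iff.1 hx, mem_singleton_iff.1 hy]
        simp
    obtain ⟨K', l2⟩ := l2
    exact ⟨_, lipschitzOnWith_Icc_union l1 (lipschitzOnWith_Icc_union l2 l3)⟩
  · rw [e1 0 ⟨le_rfl, hs⟩, h.mem.2.1]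
  · rcases hz with rfl | ⟨rfl, hz⟩
    · rw [e3 (Or.inr rfl) 1 ⟨ht, le_rfl⟩]; exact h.mem.2.2.1
    · rwa [e2 1 ⟨hst.le, le_rfl⟩, seg_right hst]
  · intro τ hτ
    rcases le_or_gt τ s with h1 | h1
    · rw [e1 τ ⟨hτ.1, h1⟩]; exact h.mem.2.2.2 τ hτ
    rcases lt_or_ge τ t with h2 | h2
    · rw [e2 τ ⟨h1.le, h2.le⟩]
      exact seg_mem_Pint hst ⟨h1.le, h2⟩ (h.mem.2.2.2 s hsI) hzP
    · rw [e3 (Or.inl (h2.trans_lt hτ.2)) τ ⟨h2, hτ.2.le⟩]; exact h.mem.2.2.2 τ hτ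

/-- The weights of a spliced curve. -/
theorem splice_isWeight (h : StarData x0 y0 α L c M) {n : ℕ} {cn p r : ℝ} (hcn : 0 < cn)
    (hs : 0 ≤ s) (hst : s < t) (ht : t ≤ 1) (hz : z ∈ Pset)
    (hr : r = √((z.1 - (α s).1) ^ 2 + (z.2 - (α s).2) ^ 2) / (t - s)) :
    IsWeight n cn p (splice α s t z)
      (spliceWeight (fun τ => Fvol n cn (α τ) * L ^ (1 - p))
        (fun τ => Fvol n cn (seg s t (α s) z τ) * r ^ (1 - p)) s t)
      (spliceWeight (fun τ => Fvol n cn (α τ) * L)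
        (fun τ => Fvol n cn (seg s t (α s) z τ) * r) s t) := by
  have hr0 : 0 ≤ r := by rw [hr]; exact div_nonneg (Real.sqrt_nonneg _) (by linarith)
  have hsI : s ∈ Icc (0:ℝ) 1 := ⟨hs, hst.le.trans ht⟩
  have hw := h.isWeight (n := n) (p := p) hcn
  have hF : BddMeas fun τ => Fvol n cn (seg s t (α s) z τ) := .of_continuousOn
    ((continuous_Fvol n cn).comp continuous_seg).continuousOn
  have hF0 : ∀ τ, s < τ → τ ≤ t → 0 ≤ Fvol n cn (seg s t (α s) z τ) := fun τ h1 h2 =>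
    Fvol_nonneg hcn (seg_mem_Pset hst ⟨h1.le, h2⟩ (h.mem.mem_Pset hsI) hz)
  have hspeed : ∀ᵐ τ ∂(volume : Measure ℝ), τ ∈ Icc (0:ℝ) 1 →
      gSpeed (splice α s t z) τ = spliceWeight (fun _ => L) (fun _ => r) s t τ := by
    have a0 : ∀ᵐ u ∂(volume : Measure ℝ), u ≠ 0 := by simp [ae_iff]
    have a1 : ∀ᵐ u ∂(volume : Measure ℝ), u ≠ 1 := by simp [ae_iff]
    have a2 : ∀ᵐ u ∂(volume : Measure ℝ), u ≠ s := by simp [ae_iff]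
    have a3 : ∀ᵐ u ∂(volume : Measure ℝ), u ≠ t := by simp [ae_iff]
    filter_upwards [h.speed, a0, a1, a2, a3] with τ hsp h0 h1 h2 h3 hτ
    have hτ' : τ ∈ Ioo (0:ℝ) 1 := ⟨lt_of_le_of_ne hτ.1 (Ne.symm h0), lt_of_le_of_ne hτ.2 h1⟩
    have hcongr : ∀ {f g : ℝ → ℝ × ℝ}, f =ᶠ[𝓝 τ] g → gSpeed f τ = gSpeed g τ := by
      intro f g hfg
      simp only [gSpeed, gSpeedOn]
      have d1 : derivWithin (fun u => (f u).1) (Icc 0 1) τ =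
          derivWithin (fun u => (g u).1) (Icc 0 1) τ :=
        ((hfg.fun_comp Prod.fst).filter_mono nhdsWithin_le_nhds).derivWithin_eq
          (congrArg Prod.fst hfg.eq_of_nhds)
      have d2 : derivWithin (fun u => (f u).2) (Icc 0 1) τ =
          derivWithin (fun u => (g u).2) (Icc 0 1) τ :=
        ((hfg.fun_comp Prod.snd).filter_mono nhdsWithin_le_nhds).derivWithin_eq
          (congrArg Prod.snd hfg.eq_of_nhds)
      rw [d1, d2]
    rcases lt_or_gt_of_ne h2 with h2 | h2
    · rw [hcongr (g := α), hsp hτ, spliceWeight, if_pos h2.le]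
      filter_upwards [Iio_mem_nhds h2] with u hu
      exact if_pos (le_of_lt hu)
    rcases lt_or_gt_of_ne h3 with h3 | h3
    · rw [hcongr (g := seg s t (α s) z), gSpeed_seg hτ', abs_of_pos (by linarith), ← hr,
        spliceWeight, if_neg (not_le.2 h2), if_pos h3.le]
      filter_upwards [Ioo_mem_nhds h2 h3] with u hu
      rw [splice, if_neg (not_le.2 hu.1), if_pos hu.2.le]
    · rw [hcongr (g := α), hsp hτ, spliceWeight, if_neg (not_le.2 h2), if_neg (not_le.2 h3)]
      filter_upwards [Ioi_mem_nhds h3] with u hu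
      rw [splice, if_neg (not_le.2 (hst.trans hu)), if_neg (not_le.2 hu)]
  refine ⟨hw.measA.ite ((hF.mul (.const _)).ite hw.measA t) s,
    hw.measB.ite ((hF.mul (.const _)).ite hw.measB t) s, fun τ hτ => ?_, fun τ hτ => ?_,
    hspeed.mono fun τ hsp hτ => ?_, hspeed.mono fun τ hsp hτ => ?_⟩
  · unfold spliceWeight
    split_ifs with h1 h2
    · exact hw.nonnegA τ hτ
    · exact mul_nonneg (hF0 τ (not_le.1 h1) h2) (Real.rpow_nonneg hr0 _)
    · exact hw.nonnegA τ hτ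
  · unfold spliceWeight
    split_ifs with h1 h2
    · exact hw.nonnegB τ hτ
    · exact mul_nonneg (hF0 τ (not_le.1 h1) h2) hr0
    · exact hw.nonnegB τ hτ
  · rw [hsp hτ]
    unfold spliceWeight splice
    split_ifs <;> rfl
  · rw [hsp hτ]
    unfold spliceWeight splice
    split_ifs <;> rfl

end StarData

theorem spliceWeight_of_mem {A D : ℝ → ℝ} {s t τ : ℝ} (h : τ ∈ Ioc s t) :
    spliceWeight A D s t τ = D τ := by
  rw [spliceWeight, if_neg (not_le.2 h.1), if_pos h.2]

theorem spliceWeight_of_le {A D : ℝ → ℝ} {s t τ : ℝ} (h : τ ≤ s) :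
    spliceWeight A D s t τ = A τ := if_pos h

theorem spliceWeight_of_gt {A D : ℝ → ℝ} {s t τ : ℝ} (hst : s ≤ t) (h : t < τ) :
    spliceWeight A D s t τ = A τ := by
  rw [spliceWeight, if_neg (not_le.2 (hst.trans_lt h)), if_neg (not_le.2 h)]

theorem TestDensity.mass_le_mass {g : ℝ → ℝ} (hg : TestDensity g) {B B' : ℝ → ℝ} (hB : BddMeas B)
    (hB' : BddMeas B') {p a b : ℝ} (hp : 0 ≤ p) (ha : a ∈ Icc (0:ℝ) 1) (hb : b ∈ Icc (0:ℝ) 1)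
    (hab : a ≤ b) (h : ∀ t ∈ Ioo a b, B t ≤ B' t) : mass p B g a b ≤ mass p B' g a b :=
  (hg.mass_bddMeas hB hp).integral_le (hg.mass_bddMeas hB' hp) ha hb hab fun t ht =>
    mul_le_mul_of_nonneg_left (h t ht) (Real.rpow_nonneg
      (hg.prim_nonneg ⟨ha.1.trans ht.1.le, ht.2.le.trans hb.2⟩) _)

theorem TestDensity.energy_le_energy {g : ℝ → ℝ} (hg : TestDensity g) {A A' : ℝ → ℝ}
    (hA : BddMeas A) (hA' : BddMeas A') {p a b : ℝ} (hp : 0 ≤ p) (ha : a ∈ Icc (0:ℝ) 1)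
    (hb : b ∈ Icc (0:ℝ) 1) (hab : a ≤ b) (h : ∀ t ∈ Ioo a b, A t ≤ A' t) :
    energy p A g a b ≤ energy p A' g a b :=
  (hg.energy_bddMeas hA hp).integral_le (hg.energy_bddMeas hA' hp) ha hb hab fun t ht =>
    mul_le_mul_of_nonneg_left (h t ht) (Real.rpow_nonneg
      (hg.nonneg t ⟨ha.1.trans ht.1.le, ht.2.le.trans hb.2⟩) _)

namespace StarData

variable {x0 y0 L c M s t : ℝ} {α : ℝ → ℝ × ℝ}

theorem norm_eq_sqrt (α : ℝ → ℝ × ℝ) (s t : ℝ) :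
    ‖cx α t - cx α s‖ = √(((α t).1 - (α s).1) ^ 2 + ((α t).2 - (α s).2) ^ 2) := by
  rw [← norm_cx_sub_sq, Real.sqrt_sq (norm_nonneg _)]

theorem chord_not_better (h : StarData x0 y0 α L c M) {n : ℕ} (hn : 2 ≤ n) {cn p r θ : ℝ}
    (hcn : 0 < cn) (hp : 2 * (n : ℝ) - 1 ≤ p)
    (hmax : ∀ γ : ℝ → ℝ × ℝ, MemRg x0 y0 γ → lambdaG n cn p γ ≤ lambdaG n cn p α)
    (hs : 0 ≤ s) (hst : s < t) (ht : t < 1) (hr : r = ‖cx α t - cx α s‖ / (t - s)) (hr0 : 0 < r)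
    (hθ : θ < 1)
    (hA : ∀ τ ∈ Ioc s t, Fvol n cn (α τ) * L ^ (1 - p) ≤
      Fvol n cn (seg s t (α s) (α t) τ) * r ^ (1 - p))
    (hB : ∀ τ ∈ Ioc s t, Fvol n cn (seg s t (α s) (α t) τ) * r ≤ θ * (Fvol n cn (α τ) * L)) :
    False := by
  have hn' : (2:ℝ) ≤ n := by exact_mod_cast hn
  have hp2 : 2 ≤ p := by linarith
  have hp0 : 0 ≤ p := by linarith
  have hsI : s ∈ Icc (0:ℝ) 1 := ⟨hs, (hst.trans ht).le⟩
  have htI : t ∈ Icc (0:ℝ) 1 := ⟨hs.trans hst.le, ht.le⟩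
  obtain ⟨CH, hCH, hH⟩ := h.exists_hardy hn hcn hp
  have hΛ := h.lambdaG_pos hn hcn hp
  have hw := h.isWeight (n := n) (p := p) hcn
  rw [norm_eq_sqrt] at hr
  have hw' := h.splice_isWeight (n := n) (p := p) hcn hs hst ht.le (h.mem.mem_Pset htI) hr
  have hγ := h.splice_memRg hs hst ht.le (Or.inl rfl)
  set A := fun τ => Fvol n cn (α τ) * L ^ (1 - p) with hAdef
  set B := fun τ => Fvol n cn (α τ) * L with hBdef
  set A' := spliceWeight A (fun τ => Fvol n cn (seg s t (α s) (α t) τ) * r ^ (1 - p)) s t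
  set B' := spliceWeight B (fun τ => Fvol n cn (seg s t (α s) (α t) τ) * r) s t
  have hBpos : ∀ τ ∈ Ioo (0:ℝ) 1, 0 < B τ := fun τ hτ =>
    mul_pos (h.Fvol_pos hcn ⟨hτ.1.le, hτ.2⟩) h.L_pos
  have hAA : ∀ τ, A τ ≤ A' τ := by
    intro τ
    rcases le_or_gt τ s with h1 | h1
    · exact (spliceWeight_of_le h1).ge
    rcases le_or_gt τ t with h2 | h2
    · exact (hA τ ⟨h1, h2⟩).trans (spliceWeight_of_mem (A := A) ⟨h1, h2⟩ :
        A' τ = _).ge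
    · exact (spliceWeight_of_gt hst.le h2).ge
  have hBθ : ∀ τ ∈ Ioc s t, B' τ ≤ θ * B τ := fun τ hτ =>
    (spliceWeight_of_mem hτ).le.trans (hB τ hτ)
  have hBB : ∀ τ ∈ Ioo (0:ℝ) 1, B' τ ≤ B τ := by
    intro τ hτ
    rcases le_or_gt τ s with h1 | h1
    · exact (spliceWeight_of_le h1).le
    rcases le_or_gt τ t with h2 | h2
    · have := hBθ τ ⟨h1, h2⟩
      nlinarith [hBpos τ hτ]
    · exact (spliceWeight_of_gt hst.le h2).le
  set m := (s + t) / 2 with hm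
  have hsm : s < m := by rw [hm]; linarith
  have hmt : m < t := by rw [hm]; linarith
  have hmI : m ∈ Icc (0:ℝ) 1 := ⟨by linarith, by linarith⟩
  have hI : 0 < ∫ τ in m..t, B τ := intervalIntegral.intervalIntegral_pos_of_pos_on
    (hw.measB.intervalIntegrable hmI htI) (fun τ hτ => hBpos τ ⟨by linarith [hτ.1],
      by linarith [hτ.2]⟩) hmt
  refine not_transfer (CH := CH) (m := m)
    (κ := lambdaG n cn p α * ((1 - θ) * ∫ τ in m..t, B τ)) (C := 2 * lambdaG n cn p α)
    hcn hp2 h.mem (hmax _ hγ) hw hw' hΛ (.const zero_le_one)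
    (mass_const_pos hp0 hw'.measB fun τ hτ => ?_) hCH.le hH ⟨by linarith, by linarith⟩
    (mul_pos hΛ (mul_pos (by linarith) hI)) (by linarith) fun g hg => ⟨g, hg, ?_, ?_⟩
  · rcases le_or_gt τ s with h1 | h1
    · exact (hBpos τ hτ).trans_le (spliceWeight_of_le h1).ge
    rcases le_or_gt τ t with h2 | h2
    · have h3 : 0 < Fvol n cn (splice α s t (α t) τ) := by
        have := hγ.2.2.2 τ ⟨hτ.1.le, hτ.2⟩
        exact mul_pos (mul_pos hcn (pow_pos this.1 _)) (pow_pos this.2 _)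
      rw [splice, if_neg (not_le.2 h1), if_pos h2] at h3
      exact (mul_pos h3 hr0).trans_le (spliceWeight_of_mem (A := B) ⟨h1, h2⟩ :
        B' τ = _).ge
    · exact (hBpos τ hτ).trans_le (spliceWeight_of_gt hst.le h2).ge
  · have e1 := hg.energy_le_energy hw.measA hw'.measA hp0 zero_mem_unit one_mem_unit zero_le_one
      fun τ _ => hAA τ
    have m1 := hg.mass_le_mass hw'.measB hw.measB hp0 zero_mem_unit hmI hmI.1
      fun τ hτ => hBB τ ⟨hτ.1, hτ.2.trans_le hmI.2⟩
    have m3 := hg.mass_le_mass hw'.measB hw.measB hp0 htI one_mem_unit htI.2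
      fun τ hτ => hBB τ ⟨htI.1.trans_lt hτ.1, hτ.2⟩
    have m2 := hg.mass_le_mass hw'.measB ((BddMeas.const θ).mul hw.measB) hp0 hmI htI hmt.le
      fun τ hτ => hBθ τ ⟨hsm.trans hτ.1, hτ.2.le⟩
    have m2' : mass p (fun τ => θ * B τ) g m t = θ * mass p B g m t := by
      rw [mass, mass, ← intervalIntegral.integral_const_mul]
      congr 1; ext τ; ring
    have m4 := hg.le_mass hw.measB hw.nonnegB hp0 hmI htI hmt.le
    have s1 := hg.mass_add hw.measB hp0 zero_mem_unit hmI one_mem_unit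
    have s2 := hg.mass_add hw.measB hp0 hmI htI one_mem_unit
    have s3 := hg.mass_add hw'.measB hp0 zero_mem_unit hmI one_mem_unit
    have s4 := hg.mass_add hw'.measB hp0 hmI htI one_mem_unit
    have key : mass p B' g 0 1 + (1 - θ) * (prim g m ^ p * ∫ τ in m..t, B τ) ≤ mass p B g 0 1 := by
      have := mul_le_mul_of_nonneg_left m4 (sub_nonneg.2 hθ.le)
      linarith
    have := mul_le_mul_of_nonneg_left key hΛ.le
    linarith
  · have m1 := hg.mass_le_mass hw'.measB hw.measB hp0 zero_mem_unit one_mem_unit zero_le_one hBB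
    have e1 := hg.energy_nonneg hw'.nonnegA (p := p) zero_mem_unit one_mem_unit zero_le_one
    have := mul_le_mul_of_nonneg_left m1 hΛ.le
    linarith

/-- The volume densities along an arc and along its chord are comparable. -/
theorem Fvol_seg_bounds (h : StarData x0 y0 α L c M) {n : ℕ} {cn τ : ℝ} (hcn : 0 < cn)
    (hs : 0 ≤ s) (hst : s < t) (ht : t < 1) (hq1 : 16 * L * M / c * (t - s) / (1 - s) < 1)
    (hτ : τ ∈ Ioc s t) :
    (1 - 16 * L * M / c * (t - s) / (1 - s)) ^ (n - 1) * Fvol n cn (α τ) ≤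
      Fvol n cn (seg s t (α s) (α t) τ) ∧
    (1 - 16 * L * M / c * (t - s) / (1 - s)) ^ (n - 1) * Fvol n cn (seg s t (α s) (α t) τ) ≤
      Fvol n cn (α τ) := by
  have hL := h.L_pos
  have hc := h.c_pos
  have hM := h.M_pos
  have hsI : s ∈ Icc (0:ℝ) 1 := ⟨hs, (hst.trans ht).le⟩
  have htI : t ∈ Icc (0:ℝ) 1 := ⟨hs.trans hst.le, ht.le⟩
  have hts : 0 < t - s := by linarith
  have h1s : 0 < 1 - s := by linarith
  set q := 16 * L * M / c * (t - s) / (1 - s) with hq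
  have hq0 : 0 ≤ q := by positivity
  have hτI : τ ∈ Icc (0:ℝ) 1 := ⟨hs.trans hτ.1.le, hτ.2.trans ht.le⟩
  have hσ := seg_mem_Pset hst ⟨hτ.1.le, hτ.2⟩ (h.mem.mem_Pset hsI) (h.mem.mem_Pset htI)
  set σ := seg s t (α s) (α t) τ with hσdef
  set w := (τ - s) / (t - s) with hw
  have hw0 : 0 ≤ w := div_nonneg (by linarith [hτ.1]) hts.le
  have hw1 : w ≤ 1 := (div_le_one hts).2 (by linarith [hτ.2])
  have hσ1 : σ.1 = (α s).1 + w * ((α t).1 - (α s).1) := rfl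
  have hσ2 : σ.2 = (α s).2 + w * ((α t).2 - (α s).2) := rfl
  have d1 := h.dist_le s hsI t htI hst.le
  have d2 := h.dist_le s hsI τ hτI hτ.1.le
  have d3 : L * (τ - s) ≤ L * (t - s) := mul_le_mul_of_nonneg_left (by linarith [hτ.2]) hL.le
  have b1 := abs_le.1 (((abs_fst_sub_le α s τ).trans d2).trans d3)
  have b2 := abs_le.1 (((abs_snd_sub_le α s τ).trans d2).trans d3)
  set D := L * (t - s) with hD
  have hD0 : 0 ≤ D := by positivity
  have hwD : ∀ {x : ℝ}, |x| ≤ D → |w * x| ≤ D := fun {x} hx => by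
    rw [abs_mul, abs_of_nonneg hw0]
    nlinarith [abs_nonneg x]
  have w1 := abs_le.1 (hwD ((abs_fst_sub_le α s t).trans d1))
  have w2 := abs_le.1 (hwD ((abs_snd_sub_le α s t).trans d1))
  have x1 : |σ.1 - (α τ).1| ≤ 2 * D := by
    rw [abs_le, hσ1]; constructor <;> linarith [w1.1, w1.2]
  have x2 : |σ.2 - (α τ).2| ≤ 2 * D := by
    rw [abs_le, hσ2]; constructor <;> linarith [w2.1, w2.2]
  have hσM : σ.2 ≤ M := by
    rw [hσ2]
    nlinarith [h.snd_le s hsI, h.snd_le t htI]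
  have hE : |σ.1 * σ.2 - (α τ).1 * (α τ).2| ≤ 4 * M * D := by
    have : σ.1 * σ.2 - (α τ).1 * (α τ).2 =
        (σ.1 - (α τ).1) * σ.2 + (α τ).1 * (σ.2 - (α τ).2) := by ring
    rw [this]
    refine (abs_add_le _ _).trans ?_
    rw [abs_mul, abs_mul, abs_of_nonneg hσ.2, abs_of_nonneg (h.fst_nonneg hτI)]
    have := mul_le_mul x1 hσM hσ.2 (by positivity)
    have := mul_le_mul (h.fst_le τ hτI) x2 (abs_nonneg _) hM.le
    linarith
  have hqE : q * (c * (1 - s) / 4) = 4 * M * D := by rw [hq, hD]; field_simp; ring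
  have hcM : c ≤ M * L := by
    have e1 := h.le_v 0 zero_mem_unit
    have e2 := (abs_snd_sub_le α 0 1).trans (h.dist_le 0 zero_mem_unit 1 one_mem_unit zero_le_one)
    rw [h.snd_one] at e2
    have e3 := (abs_le.1 e2).1
    have := mul_le_mul (h.fst_le 0 zero_mem_unit) (by linarith : (α 0).2 ≤ L)
      (h.snd_nonneg zero_mem_unit) hM.le
    linarith
  have hG : 0 < c * (1 - s) / 4 := by positivity
  have hV : c * (1 - s) / 2 ≤ (α τ).1 * (α τ).2 := by
    have e1 := h.le_v τ hτI
    have e2 : 4 * M * D < c * (1 - s) / 4 := by rw [← hqE]; exact mul_lt_of_lt_one_left hG hq1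
    have e3 : c * (t - s) ≤ M * D := by
      rw [hD, ← mul_assoc]; exact mul_le_mul_of_nonneg_right hcM hts.le
    have e4 : c * (1 - t) ≤ c * (1 - τ) := mul_le_mul_of_nonneg_left (by linarith [hτ.2]) hc.le
    linarith
  have hE' := abs_le.1 hE
  have hS : c * (1 - s) / 4 ≤ σ.1 * σ.2 := by
    have : q * (c * (1 - s) / 4) ≤ c * (1 - s) / 4 := mul_le_of_le_one_left hG.le hq1.le
    linarith [hE'.1]
  have f1 : (1 - q) * ((α τ).1 * (α τ).2) ≤ σ.1 * σ.2 := by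
    linarith [mul_le_mul_of_nonneg_left hV hq0, mul_nonneg hq0 hG.le, hE'.1]
  have f2 : (1 - q) * (σ.1 * σ.2) ≤ (α τ).1 * (α τ).2 := by
    linarith [mul_le_mul_of_nonneg_left hS hq0, hE'.2]
  have hF : ∀ z : ℝ × ℝ, Fvol n cn z = cn * (z.1 * z.2) ^ (n - 1) := fun z => by
    rw [Fvol, mul_pow, mul_assoc]
  rw [hF, hF, mul_left_comm, ← mul_pow, mul_left_comm (_ ^ _) cn, ← mul_pow]
  have q1 : 0 ≤ 1 - q := by linarith
  exact ⟨mul_le_mul_of_nonneg_left (pow_le_pow_left₀ (mul_nonneg q1 (mul_nonneg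
      (h.fst_nonneg hτI) (h.snd_nonneg hτI))) f1 _) hcn.le,
    mul_le_mul_of_nonneg_left (pow_le_pow_left₀ (mul_nonneg q1 (mul_nonneg
      hσ.1 hσ.2)) f2 _) hcn.le⟩

/-- The length of a chord of a maximizer is almost the length of the arc. -/
theorem le_chord (h : StarData x0 y0 α L c M) {n : ℕ} (hn : 2 ≤ n) {cn p : ℝ}
    (hcn : 0 < cn) (hp : 2 * (n : ℝ) - 1 ≤ p)
    (hmax : ∀ γ : ℝ → ℝ × ℝ, MemRg x0 y0 γ → lambdaG n cn p γ ≤ lambdaG n cn p α)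
    (hs : 0 ≤ s) (hst : s < t) (ht : t < 1) :
    L * (t - s) * (1 - (n - 1) * (16 * L * M / c * (t - s) / (1 - s))) ≤ ‖cx α t - cx α s‖ := by
  have hn' : (2:ℝ) ≤ n := by exact_mod_cast hn
  have hL := h.L_pos
  have hc := h.c_pos
  have hM := h.M_pos
  have hsI : s ∈ Icc (0:ℝ) 1 := ⟨hs, (hst.trans ht).le⟩
  have htI : t ∈ Icc (0:ℝ) 1 := ⟨hs.trans hst.le, ht.le⟩
  have hts : 0 < t - s := by linarith
  have h1s : 0 < 1 - s := by linarith
  set q := 16 * L * M / c * (t - s) / (1 - s) with hq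
  have hq0 : 0 ≤ q := by positivity
  by_contra! hlt
  have hk : ((n - 1 : ℕ) : ℝ) = n - 1 := by rw [Nat.cast_sub (by omega)]; simp
  have hd : 0 < ‖cx α t - cx α s‖ := by
    refine norm_pos_iff.2 (sub_ne_zero.2 fun e => hst.ne' (h.inj htI hsI ?_))
    exact Prod.ext (congrArg Complex.re e) (congrArg Complex.im e)
  have hq1 : q < 1 := by
    by_contra! hq1
    have : 1 - (n - 1) * q ≤ 0 := by nlinarith
    nlinarith [mul_pos hL hts]
  set ρ := ‖cx α t - cx α s‖ / (L * (t - s)) with hρ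
  have hρ0 : 0 < ρ := by positivity
  have hρ1 : ρ < (1 - q) ^ (n - 1) := by
    rw [hρ, div_lt_iff₀ (by positivity)]
    refine hlt.trans_le ?_
    rw [mul_comm]
    refine mul_le_mul_of_nonneg_right ?_ (by positivity)
    have := one_add_mul_le_pow (a := -q) (by linarith) (n - 1)
    rw [hk] at this
    have e : 1 + -q = 1 - q := by ring
    rw [e] at this
    linarith
  have hP : 0 < (1 - q) ^ (n - 1) := by apply pow_pos; linarith
  have hP1 : (1 - q) ^ (n - 1) ≤ 1 := pow_le_one₀ (by linarith) (by linarith)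
  have hr : ρ * L = ‖cx α t - cx α s‖ / (t - s) := by rw [hρ]; field_simp
  have hcmp : ∀ τ ∈ Ioc s t, (1 - q) ^ (n - 1) * Fvol n cn (α τ) ≤
      Fvol n cn (seg s t (α s) (α t) τ) ∧
      (1 - q) ^ (n - 1) * Fvol n cn (seg s t (α s) (α t) τ) ≤ Fvol n cn (α τ) :=
    fun τ hτ => h.Fvol_seg_bounds hcn hs hst ht hq1 hτ
  refine h.chord_not_better hn hcn hp hmax hs hst ht hr (by positivity)
    (θ := ρ / (1 - q) ^ (n - 1)) ((div_lt_one hP).2 hρ1) (fun τ hτ => ?_) fun τ hτ => ?_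
  · have hτI : τ ∈ Ico (0:ℝ) 1 := ⟨hs.trans hτ.1.le, hτ.2.trans_lt ht⟩
    have e1 : ρ⁻¹ ≤ ρ ^ (1 - p) := by
      rw [← Real.rpow_neg_one]
      exact Real.rpow_le_rpow_of_exponent_ge hρ0 (hρ1.le.trans hP1) (by linarith)
    have e2 : 1 ≤ (1 - q) ^ (n - 1) * ρ ^ (1 - p) := by
      refine le_trans ?_ (mul_le_mul_of_nonneg_left e1 hP.le)
      rw [← div_eq_mul_inv, one_le_div hρ0]
      exact hρ1.le
    rw [Real.mul_rpow hρ0.le hL.le, ← mul_assoc]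
    refine mul_le_mul_of_nonneg_right ?_ (Real.rpow_nonneg hL.le _)
    have e3 := mul_le_mul_of_nonneg_right (hcmp τ hτ).1 (Real.rpow_nonneg hρ0.le (1 - p))
    refine le_trans ?_ e3
    nlinarith [h.Fvol_pos (n := n) hcn hτI]
  · have := (hcmp τ hτ).2
    rw [div_mul_eq_mul_div ρ, le_div_iff₀ hP]
    nlinarith [mul_le_mul_of_nonneg_left this (mul_pos hρ0 hL).le]

end StarData

theorem exists_add_rpow_le {p : ℝ} (hp : 1 ≤ p) {ε : ℝ} (hε : 0 < ε) :
    ∃ C > 0, ∀ a b : ℝ, 0 ≤ a → 0 ≤ b → (a + b) ^ p ≤ (1 + ε) * a ^ p + C * b ^ p := by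
  have hcont : ContinuousAt (fun θ : ℝ => (1 - θ) ^ (1 - p)) 0 :=
    (continuousAt_const.sub continuousAt_id).rpow_const (Or.inl (by simp))
  have hev : ∀ᶠ θ in 𝓝[>] (0:ℝ), (1 - θ) ^ (1 - p) < 1 + ε :=
    (hcont.tendsto.mono_left nhdsWithin_le_nhds).eventually_lt_const (by simpa using hε)
  obtain ⟨θ, hθ, hθ0, hθ1⟩ := (hev.and (Ioo_mem_nhdsGT zero_lt_one)).exists
  refine ⟨θ ^ (1 - p), Real.rpow_pos_of_pos hθ0 _, fun a b ha hb => ?_⟩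
  have h1 : 0 < 1 - θ := by linarith
  have h := (convexOn_rpow hp).2 (x := a / (1 - θ)) (y := b / θ) (div_nonneg ha h1.le)
    (div_nonneg hb hθ0.le) h1.le hθ0.le (by ring)
  simp only [smul_eq_mul] at h
  rw [mul_div_cancel₀ _ h1.ne', mul_div_cancel₀ _ hθ0.ne', Real.div_rpow ha h1.le,
    Real.div_rpow hb hθ0.le] at h
  have e : ∀ x : ℝ, 0 < x → ∀ y : ℝ, x * (y / x ^ p) = x ^ (1 - p) * y := fun x hx y => by
    rw [Real.rpow_sub hx, Real.rpow_one]; ring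
  rw [e _ h1, e _ hθ0] at h
  have := mul_le_mul_of_nonneg_right hθ.le (Real.rpow_nonneg ha p)
  linarith

theorem integral_one_sub_pow (s : ℝ) (k : ℕ) :
    ∫ τ in s..1, (1 - τ) ^ k = (1 - s) ^ (k + 1) / (k + 1) := by
  rw [intervalIntegral.integral_comp_sub_left (fun x : ℝ => x ^ k), integral_pow]
  simp

namespace StarData

variable {x0 y0 L c M s : ℝ} {α : ℝ → ℝ × ℝ}

theorem snd_le_mul (h : StarData x0 y0 α L c M) (hs : s ∈ Icc (0:ℝ) 1) :
    (α s).2 ≤ L * (1 - s) := by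
  have e := (abs_snd_sub_le α s 1).trans (h.dist_le s hs 1 one_mem_unit hs.2)
  rw [h.snd_one] at e
  linarith [(abs_le.1 e).1]

theorem vertical_not_better (h : StarData x0 y0 α L c M) {n : ℕ} (hn : 2 ≤ n) {cn p ε C : ℝ}
    (hcn : 0 < cn) (hp : 2 * (n : ℝ) - 1 ≤ p)
    (hmax : ∀ γ : ℝ → ℝ × ℝ, MemRg x0 y0 γ → lambdaG n cn p γ ≤ lambdaG n cn p α)
    (hs : s ∈ Ioo (0:ℝ) 1)
    (hC : ∀ a b : ℝ, 0 ≤ a → 0 ≤ b → (a + b) ^ p ≤ (1 + ε) * a ^ p + C * b ^ p)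
    (hsmall : 2 * lambdaG n cn p α * (cn * (α s).1 ^ (n - 1) * (α s).2 ^ n / n) * C * 2 ^ (p - 1) ≤
      cn * c ^ (n - 1) * L ^ (1 - p)) :
    ∫ τ in s..1, Fvol n cn (α τ) * L ≤
      (1 + ε) * (cn * (α s).1 ^ (n - 1) * (α s).2 ^ n / n) := by
  by_contra! hlt
  have hn' : (2:ℝ) ≤ n := by exact_mod_cast hn
  have hp2 : 2 ≤ p := by linarith
  have hp0 : 0 ≤ p := by linarith
  have hL := h.L_pos
  have hc := h.c_pos
  have hsI : s ∈ Icc (0:ℝ) 1 := ⟨hs.1.le, hs.2.le⟩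
  have hint := h.mem.2.2.2 s ⟨hs.1.le, hs.2⟩
  have hξ : 0 < (α s).1 := hint.1
  have hη : 0 < (α s).2 := hint.2
  have hδ : 0 < 1 - s := by linarith [hs.2]
  obtain ⟨CH, hCH, hH⟩ := h.exists_hardy hn hcn hp
  have hΛ := h.lambdaG_pos hn hcn hp
  set Λ := lambdaG n cn p α
  have hw := h.isWeight (n := n) (p := p) hcn
  set ξ := (α s).1 with hξdef
  set η := (α s).2 with hηdef
  set b := cn * ξ ^ (n - 1) * η ^ n / n with hb
  have hb0 : 0 < b := by positivity
  set z : ℝ × ℝ := (ξ, 0) with hz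
  set r := η / (1 - s) with hrdef
  have hr0 : 0 < r := div_pos hη hδ
  have hrL : r ≤ L := (div_le_iff₀ hδ).2 (h.snd_le_mul hsI)
  have hr : r = √((z.1 - (α s).1) ^ 2 + (z.2 - (α s).2) ^ 2) / (1 - s) := by
    have : (z.1 - (α s).1) ^ 2 + (z.2 - (α s).2) ^ 2 = η ^ 2 := by simp [hz, hξdef, hηdef]
    rw [this, Real.sqrt_sq hη.le]
  have hzB : z ∈ Pbdry := ⟨⟨hξ.le, le_rfl⟩, Or.inr rfl⟩
  have hseg : ∀ τ, Fvol n cn (seg s 1 (α s) z τ) = cn * (ξ * r) ^ (n - 1) * (1 - τ) ^ (n - 1) := by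
    intro τ
    have e1 : (seg s 1 (α s) z τ).1 = ξ := by simp [seg, hz, hξdef]
    have e2 : (seg s 1 (α s) z τ).2 = r * (1 - τ) := by
      simp only [seg, hz, hrdef, ← hηdef]
      field_simp
      ring
    rw [Fvol, e1, e2, mul_pow, mul_pow]
    ring
  have hw' := h.splice_isWeight (n := n) (p := p) hcn hs.1.le hs.2 le_rfl hzB.1 hr
  have hγ := h.splice_memRg hs.1.le hs.2 le_rfl (Or.inr ⟨rfl, hzB⟩)
  set A := fun τ => Fvol n cn (α τ) * L ^ (1 - p) with hAdef
  set B := fun τ => Fvol n cn (α τ) * L with hBdef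
  set A' := spliceWeight A (fun τ => Fvol n cn (seg s 1 (α s) z τ) * r ^ (1 - p)) s 1
  set B' := spliceWeight B (fun τ => Fvol n cn (seg s 1 (α s) z τ) * r) s 1
  have hBpos : ∀ τ ∈ Ioo (0:ℝ) 1, 0 < B τ := fun τ hτ =>
    mul_pos (h.Fvol_pos hcn ⟨hτ.1.le, hτ.2⟩) h.L_pos
  have hA'l : ∀ τ ∈ Ioo 0 s, A' τ = A τ := fun τ hτ => spliceWeight_of_le hτ.2.le
  have hB'l : ∀ τ ∈ Ioo 0 s, B' τ = B τ := fun τ hτ => spliceWeight_of_le hτ.2.le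
  have hB'r : ∀ τ ∈ Ioo s 1, B' τ = cn * (ξ * r) ^ (n - 1) * r * (1 - τ) ^ (n - 1) := fun τ hτ =>
    (spliceWeight_of_mem (A := B) ⟨hτ.1, hτ.2.le⟩ : B' τ = _).trans (by rw [hseg]; ring)
  have hA'r : ∀ τ ∈ Ioo s 1, cn * c ^ (n - 1) * L ^ (1 - p) * (1 - τ) ^ (n - 1) ≤ A' τ := by
    intro τ hτ
    refine le_trans ?_ (spliceWeight_of_mem (A := A) ⟨hτ.1, hτ.2.le⟩ : A' τ = _).ge
    rw [hseg]
    have e1 : c ≤ ξ * r := by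
      rw [hrdef, ← mul_div_assoc, le_div_iff₀ hδ]
      exact h.le_v s hsI
    have e2 : L ^ (1 - p) ≤ r ^ (1 - p) :=
      Real.rpow_le_rpow_of_nonpos hr0 hrL (by linarith)
    have e3 : 0 ≤ 1 - τ := by linarith [hτ.2]
    calc cn * c ^ (n - 1) * L ^ (1 - p) * (1 - τ) ^ (n - 1)
        = cn * c ^ (n - 1) * (1 - τ) ^ (n - 1) * L ^ (1 - p) := by ring
      _ ≤ cn * (ξ * r) ^ (n - 1) * (1 - τ) ^ (n - 1) * r ^ (1 - p) := by gcongr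
  have hIB' : ∫ τ in s..1, B' τ = b := by
    rw [integral_congr_Ioo hs.2.le hB'r, intervalIntegral.integral_const_mul,
      integral_one_sub_pow, hb]
    obtain ⟨k, rfl⟩ : ∃ k, n = k + 1 := ⟨n - 1, by omega⟩
    rw [hrdef, Nat.add_sub_cancel, Nat.cast_add, Nat.cast_one, mul_pow, div_pow]
    field_simp
    ring
  refine not_transfer (CH := CH) (m := s)
    (κ := Λ * ((∫ τ in s..1, B τ) - (1 + ε) * b)) (C := 2 * Λ)
    hcn hp2 h.mem (hmax _ hγ) hw hw' hΛ (.const zero_le_one)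
    (mass_const_pos hp0 hw'.measB fun τ hτ => ?_) hCH.le hH hs
    (mul_pos hΛ (by linarith)) (by linarith) fun g hg =>
      ⟨fun τ => if τ ≤ s then g τ else 0, hg.ite (.const le_rfl) s, ?_⟩
  · rcases le_or_gt τ s with h1 | h1
    · exact (hBpos τ hτ).trans_le (spliceWeight_of_le h1).ge
    · rw [hB'r τ ⟨h1, hτ.2⟩]
      have : 0 < 1 - τ := by linarith [hτ.2]
      positivity
  have hg' : TestDensity fun τ => if τ ≤ s then g τ else 0 := hg.ite (.const le_rfl) s
  have E1 : energy p A (fun τ => if τ ≤ s then g τ else 0) 0 1 = energy p A g 0 s := by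
    rw [energy_ite hg (.const le_rfl) hsI hp0 hw.measA]
    simp [energy, Real.zero_rpow (by linarith : p ≠ 0)]
  have P1 : prim (fun τ => if τ ≤ s then g τ else 0) s = prim g s := prim_ite_of_le hs.1.le le_rfl
  have M1 : mass p B (fun τ => if τ ≤ s then g τ else 0) 0 1 =
      mass p B g 0 s + prim g s ^ p * ∫ τ in s..1, B τ := by
    rw [hg'.mass_add hw.measB hp0 zero_mem_unit hsI one_mem_unit]
    congr 1
    · exact integral_congr_Ioo hs.1.le fun τ hτ => by
        simp only [prim_ite_of_le hτ.1.le hτ.2.le]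
    · rw [← intervalIntegral.integral_const_mul]
      refine integral_congr_Ioo hs.2.le fun τ hτ => ?_
      rw [prim_ite_of_ge hg (.const le_rfl) hsI hτ.1.le hτ.2.le]
      simp
  have E2 : energy p A' g 0 1 = energy p A g 0 s + energy p A' g s 1 := by
    rw [hg.energy_add hw'.measA hp0 zero_mem_unit hsI one_mem_unit]
    congr 1
    exact integral_congr_Ioo hs.1.le fun τ hτ => by simp only [hA'l τ hτ]
  have M2 : mass p B' g 0 1 = mass p B g 0 s + mass p B' g s 1 := by
    rw [hg.mass_add hw'.measB hp0 zero_mem_unit hsI one_mem_unit]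
    congr 1
    exact integral_congr_Ioo hs.1.le fun τ hτ => by simp only [hB'l τ hτ]
  have hW := hg.prim_nonneg hsI
  have hm0 : 0 ≤ ∫ τ in s..1, g τ := BddMeas.integral_nonneg_of hg.nonneg hsI one_mem_unit hs.2.le
  have k1 : mass p B' g s 1 ≤ ((1 + ε) * prim g s ^ p + C * (∫ τ in s..1, g τ) ^ p) * b := by
    have e1 := hg.mass_le hw'.measB hw'.nonnegB hp0 hsI one_mem_unit hs.2.le
    rw [hIB', hg.prim_sub hsI one_mem_unit] at e1
    exact e1.trans (mul_le_mul_of_nonneg_right (hC _ _ hW hm0) hb0.le)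
  have k2 := hg.rpow_integral_le hw'.measA hn hp hsI (by positivity) hA'r
  have he0 := hg.energy_nonneg hw'.nonnegA (p := p) hsI one_mem_unit hs.2.le
  set e' := energy p A' g s 1
  set I := (∫ τ in s..1, g τ) ^ p
  have hI0 : 0 ≤ I := Real.rpow_nonneg hm0 _
  have k3 : 2 * Λ * (C * I * b) ≤ e' := by
    have t0 : (0:ℝ) < 2 ^ (p - 1) := by positivity
    have t1 := mul_le_mul_of_nonneg_right hsmall hI0
    have t2 := t1.trans k2
    refine le_of_mul_le_mul_left ?_ t0
    calc _ = 2 * Λ * b * C * 2 ^ (p - 1) * I := by ring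
      _ ≤ _ := t2
  have k4 := mul_le_mul_of_nonneg_left k1 (by linarith : 0 ≤ 2 * Λ)
  have k5 : 2 * Λ * mass p B' g s 1 ≤ 2 * Λ * ((1 + ε) * b * prim g s ^ p) + e' := by
    linarith
  rw [E1, P1, M1, E2, M2]
  constructor
  · linarith
  · have hEA := hg.energy_nonneg hw.nonnegA (p := p) zero_mem_unit hsI hs.1.le
    have := mul_le_mul_of_nonneg_left hlt.le
      (mul_nonneg (by linarith : 0 ≤ 2 * Λ) (Real.rpow_nonneg hW p))
    linarith

/-- Near the boundary, the volume under a maximizer is almost that of the vertical segment. -/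
theorem eventually_integral_le (h : StarData x0 y0 α L c M) {n : ℕ} (hn : 2 ≤ n) {cn p ε : ℝ}
    (hcn : 0 < cn) (hp : 2 * (n : ℝ) - 1 ≤ p)
    (hmax : ∀ γ : ℝ → ℝ × ℝ, MemRg x0 y0 γ → lambdaG n cn p γ ≤ lambdaG n cn p α)
    (hε : 0 < ε) :
    ∀ᶠ s in 𝓝[<] (1:ℝ), ∫ τ in s..1, Fvol n cn (α τ) * L ≤
      (1 + ε) * (cn * (α s).1 ^ (n - 1) * (α s).2 ^ n / n) := by
  have hn' : (2:ℝ) ≤ n := by exact_mod_cast hn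
  obtain ⟨C, -, hC⟩ := exists_add_rpow_le (by linarith : 1 ≤ p) hε
  have hL := h.L_pos
  have hc := h.c_pos
  have hIoo : ∀ᶠ s in 𝓝[<] (1:ℝ), s ∈ Ioo (0:ℝ) 1 := Ioo_mem_nhdsLT zero_lt_one
  have hcont : Tendsto α (𝓝[<] 1) (𝓝 (α 1)) :=
    ((h.mem.continuousOn 1 one_mem_unit).mono_of_mem_nhdsWithin
      (mem_of_superset (Ioo_mem_nhdsLT zero_lt_one) Ioo_subset_Icc_self)).tendsto
  have hG : Continuous fun z : ℝ × ℝ => 2 * lambdaG n cn p α *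
      (cn * z.1 ^ (n - 1) * z.2 ^ n / n) * C * 2 ^ (p - 1) := by fun_prop
  have hev := ((hG.tendsto _).comp hcont).eventually_lt_const
    (u := cn * c ^ (n - 1) * L ^ (1 - p)) (by
      rw [h.snd_one, zero_pow (by omega)]
      simp only [mul_zero, zero_div, zero_mul]
      positivity)
  filter_upwards [hIoo, hev] with s hs hsm
  exact h.vertical_not_better hn hcn hp hmax hs hC hsm.le

/-- The one-dimensional form of the volume comparison near the boundary. -/
theorem eventually_integral_snd_le (h : StarData x0 y0 α L c M) {n : ℕ} (hn : 2 ≤ n) {cn p ε : ℝ}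
    (hcn : 0 < cn) (hp : 2 * (n : ℝ) - 1 ≤ p)
    (hmax : ∀ γ : ℝ → ℝ × ℝ, MemRg x0 y0 γ → lambdaG n cn p γ ≤ lambdaG n cn p α)
    (hε : 0 < ε) :
    ∀ᶠ s in 𝓝[<] (1:ℝ), L * ∫ τ in s..1, (α τ).2 ^ (n - 1) ≤
      (1 + ε) * ((α s).2 ^ n / n) := by
  have hL := h.L_pos
  have hx1 := h.fst_one
  obtain ⟨e, he, he0, he1⟩ : ∃ e : ℝ, (1 + e) * (1 + e) < (1 + ε) * (1 - e) ∧ 0 < e ∧ e < 1 := by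
    have c1 : Continuous fun e : ℝ => (1 + e) * (1 + e) - (1 + ε) * (1 - e) := by fun_prop
    have := ((c1.tendsto 0).mono_left (nhdsWithin_le_nhds (s := Ioi 0))).eventually_lt_const
      (u := 0) (by simp; linarith)
    obtain ⟨e, h1, h2⟩ := (this.and (Ioo_mem_nhdsGT zero_lt_one)).exists
    exact ⟨e, by linarith, h2.1, h2.2⟩
  have hIoo : ∀ᶠ s in 𝓝[<] (1:ℝ), s ∈ Ioo (0:ℝ) 1 := Ioo_mem_nhdsLT zero_lt_one
  have hcont : Tendsto (fun s => (α s).1 ^ (n - 1)) (𝓝[<] 1) (𝓝 ((α 1).1 ^ (n - 1))) :=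
    ((continuous_fst.pow (n - 1)).tendsto _).comp
      ((h.mem.continuousOn 1 one_mem_unit).mono_of_mem_nhdsWithin
      (mem_of_superset (Ioo_mem_nhdsLT zero_lt_one) Ioo_subset_Icc_self)).tendsto
  set X := (α 1).1 ^ (n - 1) with hX
  have hX0 : 0 < X := pow_pos hx1 _
  have h1 := hcont.eventually_le_const (u := (1 + e) * X) (by nlinarith)
  have h2 := hcont.eventually_const_le (u := (1 - e) * X) (by nlinarith)
  obtain ⟨a, ha, h2⟩ := (mem_nhdsLT_iff_exists_Ioo_subset).1 h2
  have ha' : ∀ᶠ s in 𝓝[<] (1:ℝ), s ∈ Ioo a 1 := Ioo_mem_nhdsLT ha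
  filter_upwards [hIoo, h1, ha', h.eventually_integral_le hn hcn hp hmax he0] with s hs g1 gs g2
  have hsI : s ∈ Icc (0:ℝ) 1 := ⟨hs.1.le, hs.2.le⟩
  have hF : BddMeas fun τ => Fvol n cn (α τ) * L := (h.isWeight (p := p) hcn).measB
  have hy : BddMeas fun τ => (α τ).2 ^ (n - 1) := .of_continuousOn
    ((continuous_snd.pow _).comp_continuousOn h.mem.continuousOn)
  have key : ∫ τ in s..1, (cn * ((1 - e) * X) * L) * (α τ).2 ^ (n - 1) ≤
      ∫ τ in s..1, Fvol n cn (α τ) * L := by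
    refine ((BddMeas.const _).mul hy).integral_le hF hsI one_mem_unit hs.2.le fun τ hτ => ?_
    have h3 : (1 - e) * X ≤ (α τ).1 ^ (n - 1) := h2 ⟨gs.1.trans hτ.1, hτ.2⟩
    have h4 : 0 ≤ (α τ).2 := h.snd_nonneg ⟨hs.1.le.trans hτ.1.le, hτ.2.le⟩
    rw [Fvol]
    calc cn * ((1 - e) * X) * L * (α τ).2 ^ (n - 1)
        = cn * ((1 - e) * X) * (α τ).2 ^ (n - 1) * L := by ring
      _ ≤ _ := by gcongr
  rw [intervalIntegral.integral_const_mul] at key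
  have hη : 0 ≤ (α s).2 ^ n / n := div_nonneg (pow_nonneg (h.snd_nonneg hsI) _) (Nat.cast_nonneg _)
  set Y := (α s).2 ^ n / n with hY
  set I := ∫ τ in s..1, (α τ).2 ^ (n - 1)
  have e1 : (1 + e) * (cn * (α s).1 ^ (n - 1) * (α s).2 ^ n / n) ≤
      (1 + e) * (cn * ((1 + e) * X) * Y) := by
    rw [mul_div_assoc]
    gcongr
  have e2 : cn * X * ((1 - e) * (L * I)) ≤ cn * X * ((1 + e) * (1 + e) * Y) := by
    have := (key.trans g2).trans e1
    calc _ = cn * ((1 - e) * X) * L * I := by ring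
      _ ≤ _ := this
      _ = _ := by ring
  have e3 := le_of_mul_le_mul_left e2 (mul_pos hcn hX0)
  have e4 : (1 - e) * (L * I) ≤ (1 - e) * ((1 + ε) * Y) := by
    have := mul_le_mul_of_nonneg_right he.le hη
    calc _ ≤ _ := e3
      _ ≤ _ := this
      _ = _ := by ring
  exact le_of_mul_le_mul_left e4 (by linarith)

end StarData

/-- On the interval `[a, b]` the curve `β` is `L`-Lipschitz, with almost maximal chords. -/
structure AlmostGeodesic {E : Type*} [NormedAddCommGroup E] (β : ℝ → E) (L K a b : ℝ) : Prop where
  L_nonneg : 0 ≤ L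
  K_nonneg : 0 ≤ K
  norm_le : ∀ ⦃s t⦄, a ≤ s → s < t → t ≤ b → ‖β t - β s‖ ≤ L * (t - s)
  le_norm : ∀ ⦃s t⦄, a ≤ s → s < t → t ≤ b → L * (t - s) * (1 - K * (t - s)) ≤ ‖β t - β s‖

namespace AlmostGeodesic

variable {E : Type*} [NormedAddCommGroup E] {β : ℝ → E} {L K a b s t u v : ℝ}

theorem norm_sq_ge (h : AlmostGeodesic β L K a b) (has : a ≤ s) (hst : s < t) (htb : t ≤ b) :
    L ^ 2 * (t - s) ^ 2 * (1 - 2 * K * (t - s)) ≤ ‖β t - β s‖ ^ 2 := by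
  have h1 := h.le_norm has hst htb
  have hL := h.L_nonneg
  have hh : 0 < t - s := sub_pos.2 hst
  have hsq : 0 ≤ L ^ 2 * (t - s) ^ 2 := by positivity
  rcases le_or_gt 0 (1 - K * (t - s)) with h2 | h2
  · have h3 : 0 ≤ L * (t - s) * (1 - K * (t - s)) := by positivity
    have h4 := pow_le_pow_left₀ h3 h1 2
    have h5 : 0 ≤ L ^ 2 * (t - s) ^ 2 * (K * (t - s)) ^ 2 := by positivity
    nlinarith
  · have : L ^ 2 * (t - s) ^ 2 * (1 - 2 * K * (t - s)) ≤ 0 :=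
      mul_nonpos_of_nonneg_of_nonpos hsq (by linarith)
    exact this.trans (sq_nonneg _)

theorem reflect (h : AlmostGeodesic β L K a b) :
    AlmostGeodesic (fun τ => β (-τ)) L K (-b) (-a) where
  L_nonneg := h.L_nonneg
  K_nonneg := h.K_nonneg
  norm_le s t h1 h2 h3 := by
    have := h.norm_le (s := -t) (t := -s) (by linarith) (by linarith) (by linarith)
    rw [norm_sub_rev]
    convert this using 2
    ring
  le_norm s t h1 h2 h3 := by
    have := h.le_norm (s := -t) (t := -s) (by linarith) (by linarith) (by linarith)
    rw [norm_sub_rev]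
    convert this using 2 <;> ring

variable [InnerProductSpace ℝ E]

theorem slope_sub_of_le_two_mul (h : AlmostGeodesic β L K a b) (has : a ≤ s) (hsu : s < u)
    (hut : u ≤ t) (htb : t ≤ b) (hle : t - s ≤ 2 * (u - s)) :
    ‖slope β s u - slope β s t‖ ≤ L * √(2 * K * (t - s)) := by
  have hL := h.L_nonneg
  have hK := h.K_nonneg
  rcases hut.eq_or_lt with rfl | hut
  · simpa using mul_nonneg hL (Real.sqrt_nonneg _)
  have hA := h.norm_le has hsu (hut.le.trans htb)
  have hB := h.norm_le (has.trans hsu.le) hut htb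
  have hAB := h.norm_sq_ge has (hsu.trans hut) htb
  set A := β u - β s with hAd
  set B := β t - β u with hBd
  have hABe : β t - β s = A + B := by rw [hAd, hBd]; abel
  rw [hABe] at hAB
  set x := u - s with hx
  set y := t - u with hy
  have hx0 : 0 < x := sub_pos.2 hsu
  have hy0 : 0 < y := sub_pos.2 hut
  have hxy : t - s = x + y := by rw [hx, hy]; ring
  rw [hxy] at hAB hle ⊢
  have e1 : slope β s u - slope β s t = (x * (x + y))⁻¹ • (y • A - x • B) := by
    rw [slope_def_module, slope_def_module, hABe, ← hAd, hxy, ← hx]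
    match_scalars <;> field_simp <;> ring
  have e2 : ‖y • A - x • B‖ ^ 2 =
      (x + y) * (y * ‖A‖ ^ 2 + x * ‖B‖ ^ 2) - x * y * ‖A + B‖ ^ 2 := by
    rw [norm_sub_sq_real, norm_add_sq_real, norm_smul, norm_smul, inner_smul_left, inner_smul_right,
      Real.norm_of_nonneg hx0.le, Real.norm_of_nonneg hy0.le]
    simp
    ring
  have e3 : ‖y • A - x • B‖ ^ 2 ≤ (L * √(2 * K * (x + y)) * (x * (x + y))) ^ 2 := by
    have hA2 := pow_le_pow_left₀ (norm_nonneg _) hA 2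
    have hB2 := pow_le_pow_left₀ (norm_nonneg _) hB 2
    rw [e2, mul_pow, mul_pow, Real.sq_sqrt (by positivity)]
    calc (x + y) * (y * ‖A‖ ^ 2 + x * ‖B‖ ^ 2) - x * y * ‖A + B‖ ^ 2
        ≤ (x + y) * (y * (L * x) ^ 2 + x * (L * y) ^ 2) -
          x * y * (L ^ 2 * (x + y) ^ 2 * (1 - 2 * K * (x + y))) := by gcongr
      _ = L ^ 2 * (2 * K * (x + y)) * (x + y) ^ 2 * (x * y) := by ring
      _ ≤ L ^ 2 * (2 * K * (x + y)) * (x + y) ^ 2 * (x * x) := by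
          gcongr
          linarith
      _ = _ := by ring
  have e4 := le_of_sq_le_sq e3 (by positivity)
  rw [e1, norm_smul, norm_inv, Real.norm_of_nonneg (by positivity), inv_mul_le_iff₀ (by positivity)]
  linarith

theorem slope_sub_left_of_pow (h : AlmostGeodesic β L K a b) (k : ℕ) : ∀ ⦃s u t⦄, a ≤ s → s < u →
    u ≤ t → t ≤ b → t - s ≤ 2 ^ k * (u - s) →
    ‖slope β s u - slope β s t‖ ≤ 4 * (L * √(2 * K * (t - s))) := by
  have hL := h.L_nonneg
  have hK := h.K_nonneg
  induction k with
  | zero =>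
    intro s u t has hsu hut htb hle
    obtain rfl : u = t := by linarith
    simpa using mul_nonneg hL (Real.sqrt_nonneg _)
  | succ k ih =>
    intro s u t has hsu hut htb hle
    have hσ : 0 ≤ L * √(2 * K * (t - s)) := by positivity
    rcases le_or_gt (t - s) (2 * (u - s)) with h1 | h1
    · linarith [h.slope_sub_of_le_two_mul has hsu hut htb h1]
    · set m := (s + t) / 2 with hm
      have g1 := ih has hsu (t := m) (by linarith) (by linarith) (by rw [pow_succ] at hle; linarith)
      have g2 := h.slope_sub_of_le_two_mul has (u := m) (t := t) (by linarith) (by linarith) htb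
        (by linarith)
      have g3 : √(2 * K * (m - s)) ≤ 3 / 4 * √(2 * K * (t - s)) := by
        rw [Real.sqrt_le_left (by positivity), mul_pow, Real.sq_sqrt
          (mul_nonneg (by linarith) (by linarith))]
        nlinarith [mul_nonneg hK (by linarith : 0 ≤ t - s)]
      calc _ ≤ ‖slope β s u - slope β s m‖ + ‖slope β s m - slope β s t‖ :=
            norm_sub_le_norm_sub_add_norm_sub _ _ _
        _ ≤ 4 * (L * (3 / 4 * √(2 * K * (t - s)))) + L * √(2 * K * (t - s)) := by
            refine add_le_add (g1.trans ?_) g2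
            gcongr
        _ = _ := by ring

theorem slope_sub_left (h : AlmostGeodesic β L K a b) (has : a ≤ s) (hsu : s < u)
    (hut : u ≤ t) (htb : t ≤ b) :
    ‖slope β s u - slope β s t‖ ≤ 4 * (L * √(2 * K * (t - s))) := by
  obtain ⟨k, hk⟩ := pow_unbounded_of_one_lt ((t - s) / (u - s)) one_lt_two
  exact h.slope_sub_left_of_pow k has hsu hut htb
    ((div_le_iff₀ (sub_pos.2 hsu)).1 hk.le)

theorem slope_reflect (β : ℝ → E) (s t : ℝ) :
    slope (fun τ => β (-τ)) (-s) (-t) = - slope β s t := by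
  simp only [slope_def_module, neg_neg, ← neg_smul]
  congr 1
  rw [← inv_neg]
  congr 1
  ring

theorem slope_sub_right (h : AlmostGeodesic β L K a b) (has : a ≤ s) (hsu : s ≤ u)
    (hut : u < t) (htb : t ≤ b) :
    ‖slope β u t - slope β s t‖ ≤ 4 * (L * √(2 * K * (t - s))) := by
  have := h.reflect.slope_sub_left (neg_le_neg htb) (neg_lt_neg hut) (neg_le_neg hsu)
    (neg_le_neg has)
  rw [slope_reflect, slope_reflect, slope_comm, slope_comm β t s, ← neg_sub', norm_neg] at this
  convert this using 5
  ring

theorem slope_sub (h : AlmostGeodesic β L K a b) (has : a ≤ s) (hsu : s ≤ u) (huv : u < v)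
    (hvt : v ≤ t) (htb : t ≤ b) :
    ‖slope β u v - slope β s t‖ ≤ 8 * (L * √(2 * K * (t - s))) := by
  have hL := h.L_nonneg
  have hK := h.K_nonneg
  have h1 := h.slope_sub_right has hsu huv (hvt.trans htb)
  have h2 := h.slope_sub_left has (hsu.trans_lt huv) hvt htb
  have h3 : L * √(2 * K * (v - s)) ≤ L * √(2 * K * (t - s)) := by gcongr
  linarith [norm_sub_le_norm_sub_add_norm_sub (slope β u v) (slope β s v) (slope β s t)]

theorem tendsto_modulus (L K s : ℝ) :
    Tendsto (fun v => 8 * (L * √(2 * K * (v - s)))) (𝓝 s) (𝓝 0) := by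
  have : Continuous fun v => 8 * (L * √(2 * K * (v - s))) := by fun_prop
  simpa using this.tendsto s

theorem exists_hasDerivWithinAt [CompleteSpace E] (h : AlmostGeodesic β L K a b) (has : a ≤ s)
    (hsb : s < b) :
    ∃ D, HasDerivWithinAt β D (Ioi s) s := by
  have hcauchy : Cauchy (map (slope β s) (𝓝[>] s)) := by
    refine Metric.cauchy_iff.2 ⟨inferInstance, fun ε hε => ?_⟩
    have h1 := (((tendsto_modulus L K s).mono_left nhdsWithin_le_nhds).eventually_lt_const
      (half_pos hε)).and (Ioo_mem_nhdsGT hsb)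
    obtain ⟨v, hv, hsv, hvb⟩ := h1.exists
    refine ⟨slope β s '' Ioo s v, image_mem_map (Ioo_mem_nhdsGT hsv), ?_⟩
    rintro _ ⟨x, hx, rfl⟩ _ ⟨y, hy, rfl⟩
    have g1 := h.slope_sub has le_rfl hx.1 hx.2.le hvb.le
    have g2 := h.slope_sub has le_rfl hy.1 hy.2.le hvb.le
    rw [dist_eq_norm]
    rw [norm_sub_rev] at g2
    linarith [norm_sub_le_norm_sub_add_norm_sub (slope β s x) (slope β s v) (slope β s y)]
  obtain ⟨D, hD⟩ := cauchy_map_iff_exists_tendsto.1 hcauchy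
  exact ⟨D, (hasDerivWithinAt_iff_tendsto_slope' self_notMem_Ioi).2 hD⟩

theorem norm_deriv_sub_slope_le (h : AlmostGeodesic β L K a b) {D : E} (has : a ≤ s) (hsu : s ≤ u)
    (hut : u < t) (htb : t ≤ b) (hD : HasDerivWithinAt β D (Ioi u) u) :
    ‖D - slope β s t‖ ≤ 8 * (L * √(2 * K * (t - s))) := by
  have h1 := (hasDerivWithinAt_iff_tendsto_slope' self_notMem_Ioi).1 hD
  refine le_of_tendsto (h1.sub_const _).norm ?_
  filter_upwards [Ioo_mem_nhdsGT hut] with v hv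
  exact h.slope_sub has hsu hv.1 hv.2.le htb

theorem norm_deriv_eq (h : AlmostGeodesic β L K a b) {D : E} (has : a ≤ s) (hsb : s < b)
    (hD : HasDerivWithinAt β D (Ioi s) s) : ‖D‖ = L := by
  have h1 := ((hasDerivWithinAt_iff_tendsto_slope' self_notMem_Ioi).1 hD).norm
  have hlow : Tendsto (fun t => L * (1 - K * (t - s))) (𝓝[>] s) (𝓝 L) := by
    have : Continuous fun t => L * (1 - K * (t - s)) := by fun_prop
    simpa using (this.tendsto s).mono_left (nhdsWithin_le_nhds (s := Ioi s))
  refine tendsto_nhds_unique h1 (tendsto_of_tendsto_of_tendsto_of_le_of_le' hlow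
    tendsto_const_nhds ?_ ?_) <;>
  · filter_upwards [Ioo_mem_nhdsGT hsb] with t ht
    have hts : 0 < t - s := sub_pos.2 ht.1
    rw [slope_def_module, norm_smul, norm_inv, Real.norm_of_nonneg hts.le]
    first
    | rw [le_inv_mul_iff₀ hts]
      linarith [h.le_norm has ht.1 ht.2.le]
    | rw [inv_mul_le_iff₀ hts]
      linarith [h.norm_le has ht.1 ht.2.le]

theorem norm_deriv_sub_le (h : AlmostGeodesic β L K a b) {D D' : E} (has : a ≤ s) (hst : s ≤ t)
    (htb : t < b) (hD : HasDerivWithinAt β D (Ioi s) s) (hD' : HasDerivWithinAt β D' (Ioi t) t) :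
    ‖D' - D‖ ≤ 16 * (L * √(2 * K * (t - s))) := by
  have hlim : Tendsto (fun v => 16 * (L * √(2 * K * (v - s)))) (𝓝[>] t)
      (𝓝 (16 * (L * √(2 * K * (t - s))))) := by
    have : Continuous fun v => 16 * (L * √(2 * K * (v - s))) := by fun_prop
    exact (this.tendsto t).mono_left nhdsWithin_le_nhds
  refine ge_of_tendsto hlim ?_
  filter_upwards [Ioo_mem_nhdsGT htb] with v hv
  have h1 := h.norm_deriv_sub_slope_le has le_rfl (hst.trans_lt hv.1) hv.2.le hD
  have h2 := h.norm_deriv_sub_slope_le has hst hv.1 hv.2.le hD'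
  rw [norm_sub_rev] at h1
  linarith [norm_sub_le_norm_sub_add_norm_sub D' (slope β s v) D]

end AlmostGeodesic

namespace StarData

variable {x0 y0 L c M : ℝ} {α : ℝ → ℝ × ℝ}

theorem almostGeodesic (h : StarData x0 y0 α L c M) {n : ℕ} (hn : 2 ≤ n) {cn p b : ℝ}
    (hcn : 0 < cn) (hp : 2 * (n : ℝ) - 1 ≤ p)
    (hmax : ∀ γ : ℝ → ℝ × ℝ, MemRg x0 y0 γ → lambdaG n cn p γ ≤ lambdaG n cn p α)
    (hb : b < 1) :
    AlmostGeodesic (cx α) L ((n - 1) * (16 * L * M / c) / (1 - b)) 0 b := by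
  have hn' : (2:ℝ) ≤ n := by exact_mod_cast hn
  have hL := h.L_pos
  have hc := h.c_pos
  have hM := h.M_pos
  have hn1 : (0:ℝ) ≤ n - 1 := by linarith
  have hb1 : 0 < 1 - b := by linarith
  have hK : 0 ≤ (n - 1) * (16 * L * M / c) / (1 - b) := by positivity
  refine ⟨hL.le, hK, fun s t h0 hst htb => h.dist_le s ⟨h0, by linarith⟩ t
    ⟨by linarith, by linarith⟩ hst.le, fun s t h0 hst htb => ?_⟩
  refine le_trans ?_ (h.le_chord hn hcn hp hmax h0 hst (by linarith))
  have hst' : 0 < t - s := by linarith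
  refine mul_le_mul_of_nonneg_left ?_ (by positivity)
  have : (n - 1) * (16 * L * M / c * (t - s) / (1 - s)) ≤
      (n - 1) * (16 * L * M / c * (t - s) / (1 - b)) := by
    gcongr
    linarith
  have e : (n - 1) * (16 * L * M / c * (t - s) / (1 - b)) =
      (n - 1) * (16 * L * M / c) / (1 - b) * (t - s) := by ring
  linarith

/-- A maximizer has a continuous right derivative of constant norm on `[0,1)`. -/
theorem exists_velocity (h : StarData x0 y0 α L c M) {n : ℕ} (hn : 2 ≤ n) {cn p : ℝ}
    (hcn : 0 < cn) (hp : 2 * (n : ℝ) - 1 ≤ p)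
    (hmax : ∀ γ : ℝ → ℝ × ℝ, MemRg x0 y0 γ → lambdaG n cn p γ ≤ lambdaG n cn p α) :
    ∃ D : ℝ → ℂ, (∀ t ∈ Ico (0:ℝ) 1, HasDerivWithinAt (cx α) (D t) (Ioi t) t) ∧
      (∀ t ∈ Ico (0:ℝ) 1, ‖D t‖ = L) ∧ ContinuousOn D (Ico 0 1) ∧
      ∃ K : ℝ, ∀ t ∈ Ico (0:ℝ) 1, ∀ ε ∈ Ioc (0:ℝ) (1 / 2),
        ‖D t - slope (cx α) t (t + ε * (1 - t))‖ ≤ 8 * (L * √(4 * K * ε)) := by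
  have hn' : (2:ℝ) ≤ n := by exact_mod_cast hn
  have hL := h.L_pos
  have hc := h.c_pos
  have hM := h.M_pos
  have hn1 : (0:ℝ) ≤ n - 1 := by linarith
  have hG := fun b (hb : b < 1) => h.almostGeodesic hn hcn hp hmax hb
  have hK : 0 ≤ (n - 1) * (16 * L * M / c) := by positivity
  set K := (n - 1) * (16 * L * M / c)
  have hD : ∀ t ∈ Ico (0:ℝ) 1, HasDerivWithinAt (cx α) (derivWithin (cx α) (Ioi t) t) (Ioi t) t :=
    fun t ht => by
      obtain ⟨D, hD⟩ := (hG ((t + 1) / 2) (by linarith [ht.2])).exists_hasDerivWithinAt ht.1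
        (by linarith [ht.2])
      exact hD.differentiableWithinAt.hasDerivWithinAt
  refine ⟨fun t => derivWithin (cx α) (Ioi t) t, hD, fun t ht => ?_, fun t ht => ?_, K,
    fun t ht ε hε => ?_⟩
  · exact (hG ((t + 1) / 2) (by linarith [ht.2])).norm_deriv_eq ht.1 (by linarith [ht.2]) (hD t ht)
  · set b := (t + 1) / 2 with hb
    have htb : t < b := by linarith [ht.2]
    have hb1 : b < 1 := by linarith [ht.2]
    have hlim : Tendsto (fun s => 16 * (L * √(2 * (K / (1 - b)) * |s - t|))) (𝓝[Ico 0 1] t)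
        (𝓝 0) := by
      have : Continuous fun s => 16 * (L * √(2 * (K / (1 - b)) * |s - t|)) := by fun_prop
      simpa using (this.tendsto t).mono_left (nhdsWithin_le_nhds (s := Ico 0 1))
    refine tendsto_iff_norm_sub_tendsto_zero.2 (squeeze_zero' (Eventually.of_forall fun _ =>
      norm_nonneg _) ?_ hlim)
    filter_upwards [self_mem_nhdsWithin, nhdsWithin_le_nhds (Iio_mem_nhds htb)] with s hs hsb
    rcases le_total s t with hst | hst
    · rw [norm_sub_rev, abs_sub_comm, abs_of_nonneg (sub_nonneg.2 hst)]
      exact (hG b hb1).norm_deriv_sub_le hs.1 hst htb (hD s hs) (hD t ht)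
    · rw [abs_of_nonneg (sub_nonneg.2 hst)]
      exact (hG b hb1).norm_deriv_sub_le ht.1 hst hsb (hD t ht) (hD s hs)
  · have hδ : 0 < 1 - t := by linarith [ht.2]
    have hb : t + ε * (1 - t) < 1 := by nlinarith [hε.2]
    refine ((hG _ hb).norm_deriv_sub_slope_le ht.1 le_rfl
      (by nlinarith [hε.1]) le_rfl (hD t ht)).trans ?_
    refine mul_le_mul_of_nonneg_left (mul_le_mul_of_nonneg_left (Real.sqrt_le_sqrt ?_) hL.le)
      (by norm_num)
    have h2 : (1 - t) / 2 ≤ 1 - (t + ε * (1 - t)) := by nlinarith [hε.2]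
    have h3 : K / (1 - (t + ε * (1 - t))) ≤ K / ((1 - t) / 2) := by gcongr
    have h4 : 0 ≤ ε * (1 - t) := mul_nonneg hε.1.le hδ.le
    calc 2 * (K / (1 - (t + ε * (1 - t)))) * (t + ε * (1 - t) - t)
        = 2 * (K / (1 - (t + ε * (1 - t)))) * (ε * (1 - t)) := by ring
      _ ≤ 2 * (K / ((1 - t) / 2)) * (ε * (1 - t)) := by gcongr
      _ = _ := by field_simp; ring

theorem hasDerivWithinAt_snd {D : ℂ} {s : Set ℝ} {t : ℝ} (hD : HasDerivWithinAt (cx α) D s t) :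
    HasDerivWithinAt (fun τ => (α τ).2) D.im s t :=
  Complex.imCLM.hasFDerivAt.comp_hasDerivWithinAt t hD

theorem hasDerivWithinAt_fst {D : ℂ} {s : Set ℝ} {t : ℝ} (hD : HasDerivWithinAt (cx α) D s t) :
    HasDerivWithinAt (fun τ => (α τ).1) D.re s t :=
  Complex.reCLM.hasFDerivAt.comp_hasDerivWithinAt t hD

theorem bddMeas_im {D : ℝ → ℂ} (hDc : ContinuousOn D (Ico 0 1))
    (hDL : ∀ t ∈ Ico (0:ℝ) 1, ‖D t‖ = L) : BddMeas fun t => (D t).im := by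
  refine ⟨?_, max L ‖D 1‖, fun t ht => ?_⟩
  · rw [← Measure.restrict_congr_set Ico_ae_eq_Icc]
    exact (Complex.continuous_im.comp_continuousOn hDc).aestronglyMeasurable measurableSet_Ico
  · refine (Complex.abs_im_le_norm _).trans ?_
    rcases ht.2.eq_or_lt with rfl | h1
    · exact le_max_right _ _
    · exact (hDL t ⟨ht.1, h1⟩).le.trans (le_max_left _ _)

theorem neg_le_im {z : ℂ} (hz : ‖z‖ = L) : 0 ≤ L + z.im := by
  have := (abs_le.1 (Complex.abs_im_le_norm z)).1
  linarith

/-- Lower bound for the loss of volume by the deviation of the velocity from the vertical. -/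
theorem deviation_le (h : StarData x0 y0 α L c M) {n : ℕ} (hn : 2 ≤ n) {D : ℝ → ℂ}
    (hD : ∀ t ∈ Ico (0:ℝ) 1, HasDerivWithinAt (cx α) (D t) (Ioi t) t)
    (hDL : ∀ t ∈ Ico (0:ℝ) 1, ‖D t‖ = L) (hDc : ContinuousOn D (Ico 0 1)) {t ε : ℝ}
    (ht : t ∈ Ico (0:ℝ) 1) (hε : ε ∈ Ioc (0:ℝ) (1 / 2)) :
    (c / (2 * M)) ^ (n - 1) * ε * (1 - t) ^ n *
        (L + (slope (cx α) t (t + ε * (1 - t))).im) ≤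
      L * (∫ τ in t..1, (α τ).2 ^ (n - 1)) - (α t).2 ^ n / n := by
  have hn0 : (n : ℝ) ≠ 0 := by positivity
  have hM := h.M_pos
  have hc := h.c_pos
  have hδ : 0 < 1 - t := by linarith [ht.2]
  set s := t + ε * (1 - t) with hs
  have hts : t < s := by nlinarith [hε.1]
  have hs1 : s < 1 := by nlinarith [hε.2]
  have htI : t ∈ Icc (0:ℝ) 1 := ⟨ht.1, ht.2.le⟩
  have hsI : s ∈ Icc (0:ℝ) 1 := ⟨ht.1.trans hts.le, hs1.le⟩
  have hyc : ContinuousOn (fun τ => (α τ).2) (Icc 0 1) :=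
    continuous_snd.comp_continuousOn h.mem.continuousOn
  have hy : BddMeas fun τ => (α τ).2 ^ (n - 1) := .of_continuousOn (hyc.pow _)
  have him := bddMeas_im hDc hDL
  have hQ : BddMeas fun τ => L + (D τ).im := (BddMeas.const L).add him
  have hyQ := hy.mul hQ
  have ftc1 : ∫ τ in t..1, (α τ).2 ^ (n - 1) * (D τ).im = - ((α t).2 ^ n / n) := by
    have := intervalIntegral.integral_eq_sub_of_hasDeriv_right_of_le (f := fun τ => (α τ).2 ^ n / n)
      (f' := fun τ => (α τ).2 ^ (n - 1) * (D τ).im) htI.2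
      (((hyc.pow n).div_const _).mono (Icc_subset_Icc htI.1 le_rfl))
      (fun τ hτ => by
        have := ((hasDerivWithinAt_snd (hD τ ⟨ht.1.trans hτ.1.le, hτ.2⟩)).pow n).div_const (n : ℝ)
        refine this.congr_deriv ?_
        field_simp)
      ((hy.mul him).intervalIntegrable htI one_mem_unit)
    rw [this, h.snd_one, zero_pow (by omega)]
    simp
  have ftc2 : ∫ τ in t..s, (L + (D τ).im) = (s - t) * (L + (slope (cx α) t s).im) := by
    have := intervalIntegral.integral_eq_sub_of_hasDeriv_right_of_le
      (f := fun τ => L * τ + (α τ).2) (f' := fun τ => L + (D τ).im) hts.le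
      (((continuousOn_const.mul continuousOn_id).add hyc).mono (Icc_subset_Icc htI.1 hsI.2))
      (fun τ hτ => by
        have h1 := hasDerivWithinAt_snd (hD τ ⟨ht.1.trans hτ.1.le, hτ.2.trans hs1⟩)
        have h2 := ((hasDerivAt_id τ).const_mul L).hasDerivWithinAt (s := Ioi τ)
        refine (h2.add h1).congr_deriv ?_
        simp)
      (hQ.intervalIntegrable htI hsI)
    rw [this]
    have hne : s - t ≠ 0 := by linarith
    have e : (slope (cx α) t s).im = (s - t)⁻¹ * ((α s).2 - (α t).2) := by
      rw [slope_def_module, Complex.smul_im, Complex.sub_im, smul_eq_mul, cx, cx]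
    rw [e]
    field_simp
    ring
  have split : L * (∫ τ in t..1, (α τ).2 ^ (n - 1)) - (α t).2 ^ n / n =
      ∫ τ in t..1, (α τ).2 ^ (n - 1) * (L + (D τ).im) := by
    simp_rw [mul_add]
    rw [intervalIntegral.integral_add ((hy.mul (.const L)).intervalIntegrable htI one_mem_unit)
      ((hy.mul him).intervalIntegrable htI one_mem_unit), ftc1, intervalIntegral.integral_mul_const]
    ring
  have hy0 : ∀ τ ∈ Ico (0:ℝ) 1, 0 ≤ (α τ).2 ^ (n - 1) * (L + (D τ).im) := fun τ hτ =>
    mul_nonneg (pow_nonneg (h.snd_nonneg ⟨hτ.1, hτ.2.le⟩) _) (neg_le_im (hDL τ hτ))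
  have htail : 0 ≤ ∫ τ in s..1, (α τ).2 ^ (n - 1) * (L + (D τ).im) := by
    have := (BddMeas.const 0).integral_le hyQ hsI one_mem_unit hs1.le fun τ hτ =>
      hy0 τ ⟨hsI.1.trans hτ.1.le, hτ.2⟩
    simpa using this
  have hhead : (c / (2 * M) * (1 - t)) ^ (n - 1) * ∫ τ in t..s, (L + (D τ).im) ≤
      ∫ τ in t..s, (α τ).2 ^ (n - 1) * (L + (D τ).im) := by
    rw [← intervalIntegral.integral_const_mul]
    refine ((BddMeas.const _).mul hQ).integral_le hyQ htI hsI hts.le fun τ hτ => ?_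
    have hτI : τ ∈ Ico (0:ℝ) 1 := ⟨ht.1.trans hτ.1.le, hτ.2.trans hs1⟩
    have hτI' : τ ∈ Icc (0:ℝ) 1 := ⟨hτI.1, hτI.2.le⟩
    refine mul_le_mul_of_nonneg_right ?_ (neg_le_im (hDL τ hτI))
    refine pow_le_pow_left₀ (by positivity) ?_ _
    have h1 := h.le_v τ hτI'
    have h2 := mul_le_mul_of_nonneg_right (h.fst_le τ hτI') (h.snd_nonneg hτI')
    have h3 : (1 - t) / 2 ≤ 1 - τ := by nlinarith [hτ.2, hε.2]
    have h4 := mul_le_mul_of_nonneg_left h3 hc.le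
    refine le_of_mul_le_mul_left ?_ hM
    calc M * (c / (2 * M) * (1 - t)) = c * ((1 - t) / 2) := by field_simp
      _ ≤ _ := by linarith
  rw [split, ← hyQ.integral_add_adjacent htI hsI one_mem_unit]
  refine le_trans (le_of_eq ?_) (hhead.trans (le_add_of_nonneg_right htail))
  rw [ftc2]
  obtain ⟨k, rfl⟩ : ∃ k, n = k + 1 := ⟨n - 1, by omega⟩
  have : s - t = ε * (1 - t) := by rw [hs]; ring
  rw [this, Nat.add_sub_cancel, mul_pow, pow_succ (1 - t)]
  ring

/-- The velocity of a maximizer becomes vertical at the boundary. -/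
theorem tendsto_velocity (h : StarData x0 y0 α L c M) {n : ℕ} (hn : 2 ≤ n) {cn p : ℝ}
    (hcn : 0 < cn) (hp : 2 * (n : ℝ) - 1 ≤ p)
    (hmax : ∀ γ : ℝ → ℝ × ℝ, MemRg x0 y0 γ → lambdaG n cn p γ ≤ lambdaG n cn p α)
    {D : ℝ → ℂ} (hD : ∀ t ∈ Ico (0:ℝ) 1, HasDerivWithinAt (cx α) (D t) (Ioi t) t)
    (hDL : ∀ t ∈ Ico (0:ℝ) 1, ‖D t‖ = L) (hDc : ContinuousOn D (Ico 0 1)) {K : ℝ}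
    (hK : ∀ t ∈ Ico (0:ℝ) 1, ∀ ε ∈ Ioc (0:ℝ) (1 / 2),
        ‖D t - slope (cx α) t (t + ε * (1 - t))‖ ≤ 8 * (L * √(4 * K * ε))) :
    Tendsto D (𝓝[<] 1) (𝓝 ⟨0, -L⟩) := by
  have hn' : (2:ℝ) ≤ n := by exact_mod_cast hn
  have hL := h.L_pos
  have hM := h.M_pos
  have hc := h.c_pos
  have hIoo : ∀ᶠ s in 𝓝[<] (1:ℝ), s ∈ Ioo (0:ℝ) 1 := Ioo_mem_nhdsLT zero_lt_one
  have key : Tendsto (fun t => L + (D t).im) (𝓝[<] 1) (𝓝 0) := by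
    rw [Metric.tendsto_nhds]
    intro η hη
    obtain ⟨ε, hεη, hε⟩ : ∃ ε : ℝ, ε + 8 * (L * √(4 * K * ε)) < η ∧ ε ∈ Ioc (0:ℝ) (1 / 2) := by
      have c1 : Continuous fun ε : ℝ => ε + 8 * (L * √(4 * K * ε)) := by fun_prop
      have := ((c1.tendsto 0).mono_left (nhdsWithin_le_nhds (s := Ioi 0))).eventually_lt_const
        (u := η) (by simpa using hη)
      exact (this.and (Ioc_mem_nhdsGT (by norm_num : (0:ℝ) < 1 / 2))).exists
    have hε0 := hε.1
    set q := (c / (2 * M)) ^ (n - 1) * ε with hq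
    have hq0 : 0 < q := by positivity
    filter_upwards [hIoo, h.eventually_integral_snd_le hn hcn hp hmax
      (by positivity : 0 < q * ε / L ^ n)] with t ht hvol
    have ht' : t ∈ Ico (0:ℝ) 1 := ⟨ht.1.le, ht.2⟩
    have htI : t ∈ Icc (0:ℝ) 1 := ⟨ht.1.le, ht.2.le⟩
    have hδ : 0 < 1 - t := by linarith [ht.2]
    have e1 := h.deviation_le hn hD hDL hDc ht' hε
    have e2 : (α t).2 ^ n / n ≤ L ^ n * (1 - t) ^ n := by
      have h1 := pow_le_pow_left₀ (h.snd_nonneg htI) (h.snd_le_mul htI) n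
      rw [mul_pow] at h1
      exact (div_le_self (pow_nonneg (h.snd_nonneg htI) _) (by linarith)).trans h1
    have e3 : q * (1 - t) ^ n * (L + (slope (cx α) t (t + ε * (1 - t))).im) ≤
        q * (1 - t) ^ n * ε := by
      calc _ ≤ q * ε / L ^ n * ((α t).2 ^ n / n) := by linarith
        _ ≤ q * ε / L ^ n * (L ^ n * (1 - t) ^ n) := by gcongr
        _ = _ := by field_simp
    have e4 := le_of_mul_le_mul_left e3 (by positivity)
    have e5 := (Complex.abs_im_le_norm _).trans (hK t ht' ε hε)
    rw [Complex.sub_im] at e5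
    have e6 := (abs_le.1 e5).2
    rw [Real.dist_eq, sub_zero, abs_of_nonneg (neg_le_im (hDL t ht'))]
    linarith
  have hsq : Tendsto (fun t => √(2 * L * (L + (D t).im))) (𝓝[<] 1) (𝓝 0) := by
    simpa using (key.const_mul (2 * L)).sqrt
  refine tendsto_iff_norm_sub_tendsto_zero.2 (hsq.congr' ?_)
  filter_upwards [hIoo] with t ht
  have h1 := hDL t ⟨ht.1.le, ht.2⟩
  have h2 : (D t).re * (D t).re + (D t).im * (D t).im = L ^ 2 := by
    rw [← h1, Complex.sq_norm, Complex.normSq_apply]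
  rw [Complex.norm_def, Complex.normSq_apply]
  congr 1
  simp
  nlinarith

end StarData

/-- A continuous function with a right derivative that extends continuously is `C¹`. -/
theorem contDiffOn_of_hasDerivWithinAt_Ioi {f f' : ℝ → ℝ} (hf : ContinuousOn f (Icc 0 1))
    (hf' : ContinuousOn f' (Icc 0 1)) (hd : ∀ t ∈ Ioo (0:ℝ) 1, HasDerivWithinAt f (f' t) (Ioi t) t) :
    ContDiffOn ℝ 1 f (Icc 0 1) ∧
      ∀ t ∈ Icc (0:ℝ) 1, HasDerivWithinAt f (f' t) (Icc 0 1) t := by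
  set g : ℝ → ℝ := IccExtend zero_le_one ((Icc (0:ℝ) 1).domRestrict f')
  have hg : Continuous g := (continuousOn_iff_continuous_domRestrict.1 hf').Icc_extend'
  have hgf : ∀ t ∈ Icc (0:ℝ) 1, g t = f' t := fun t ht => IccExtend_of_mem _ _ ht
  have hG : ∀ t, HasDerivAt (fun t => f 0 + ∫ s in (0:ℝ)..t, g s) (g t) t := fun t =>
    (intervalIntegral.integral_hasDerivAt_right (hg.intervalIntegrable _ _)
      (hg.stronglyMeasurableAtFilter _ _) hg.continuousAt).const_add _
  have heq : ∀ t ∈ Icc (0:ℝ) 1, f t = f 0 + ∫ s in (0:ℝ)..t, g s := fun t ht => by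
    have := intervalIntegral.integral_eq_sub_of_hasDeriv_right_of_le (f := f) (f' := g) ht.1
      (hf.mono (Icc_subset_Icc le_rfl ht.2)) (fun s hs => by
        rw [hgf s ⟨hs.1.le, hs.2.le.trans ht.2⟩]
        exact hd s ⟨hs.1, hs.2.trans_le ht.2⟩) (hg.intervalIntegrable _ _)
    rw [this]
    ring
  have hG1 : ContDiff ℝ 1 fun t => f 0 + ∫ s in (0:ℝ)..t, g s := by
    refine contDiff_one_iff_deriv.2 ⟨fun t => (hG t).differentiableAt, ?_⟩
    rwa [funext fun t => (hG t).deriv]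
  exact ⟨hG1.contDiffOn.congr heq, fun t ht =>
    hgf t ht ▸ (hG t).hasDerivWithinAt.congr heq (heq t ht)⟩

theorem StarData.memC_of_velocity {x0 y0 c M : ℝ} {α : ℝ → ℝ × ℝ}
    (h : StarData x0 y0 α (Lg α) c M) {D : ℝ → ℂ}
    (hD : ∀ t ∈ Ico (0:ℝ) 1, HasDerivWithinAt (cx α) (D t) (Ioi t) t)
    (hDL : ∀ t ∈ Ico (0:ℝ) 1, ‖D t‖ = Lg α) (hDc : ContinuousOn D (Ico 0 1))
    (hlim : Tendsto D (𝓝[<] 1) (𝓝 ⟨0, -Lg α⟩)) : MemC x0 y0 α := by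
  set V : ℝ → ℂ := fun t => if t < 1 then D t else ⟨0, -Lg α⟩ with hVdef
  have hVD : ∀ t < 1, V t = D t := fun t ht => if_pos ht
  have hV1 : V 1 = ⟨0, -Lg α⟩ := if_neg (lt_irrefl _)
  have hVc : ContinuousOn V (Icc 0 1) := by
    intro t ht
    rcases ht.2.eq_or_lt with rfl | h1
    · have hc1 : ContinuousWithinAt V (Iio 1) 1 := by
        rw [ContinuousWithinAt, hV1]
        exact hlim.congr' (eventually_nhdsWithin_of_forall fun s hs => (hVD s hs).symm)
      have := continuousWithinAt_insert_self.2 hc1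
      rw [Iio_insert] at this
      exact this.mono Icc_subset_Iic_self
    · have hc2 : ContinuousWithinAt V (Ico 0 1) t :=
        (hDc t ⟨ht.1, h1⟩).congr (fun s hs => hVD s hs.2) (hVD t h1)
      refine hc2.mono_of_mem_nhdsWithin ?_
      filter_upwards [self_mem_nhdsWithin, nhdsWithin_le_nhds (Iio_mem_nhds h1)] with s hs hs1
      exact ⟨hs.1, hs1⟩
  have hVL : ∀ t ∈ Icc (0:ℝ) 1, ‖V t‖ = Lg α := by
    intro t ht
    rcases ht.2.eq_or_lt with rfl | h1
    · rw [hV1, Complex.norm_def, Complex.normSq_apply]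
      simp [Real.sqrt_mul_self, h.L_pos.le]
    · rw [hVD t h1, hDL t ⟨ht.1, h1⟩]
  have hVd : ∀ t ∈ Ioo (0:ℝ) 1, HasDerivWithinAt (cx α) (V t) (Ioi t) t := fun t ht => by
    rw [hVD t ht.2]
    exact hD t ⟨ht.1.le, ht.2⟩
  obtain ⟨c1, d1⟩ := contDiffOn_of_hasDerivWithinAt_Ioi (f := fun t => (α t).1)
    (f' := fun t => (V t).re)
    (continuous_fst.comp_continuousOn h.mem.continuousOn)
    (Complex.continuous_re.comp_continuousOn hVc) fun t ht => StarData.hasDerivWithinAt_fst (hVd t ht)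
  obtain ⟨c2, d2⟩ := contDiffOn_of_hasDerivWithinAt_Ioi (f := fun t => (α t).2)
    (f' := fun t => (V t).im)
    (continuous_snd.comp_continuousOn h.mem.continuousOn)
    (Complex.continuous_im.comp_continuousOn hVc) fun t ht => StarData.hasDerivWithinAt_snd (hVd t ht)
  have hu := uniqueDiffOn_Icc (zero_lt_one' ℝ)
  refine ⟨c1.prodMk c2, h.mem.2.1, h.mem.2.2.2, h.mem.2.2.1, fun h0 => ?_, fun t ht => ?_,
    fun h0 => ?_, fun _ => ?_⟩
  · exact h.fst_one.ne' (by rw [h0])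
  · rw [gSpeed, gSpeedOn, (d1 t ht).derivWithin (hu t ht), (d2 t ht).derivWithin (hu t ht),
      ← hVL t ht, Complex.norm_def, Complex.normSq_apply]
    congr 1
    ring
  · exact absurd h0 h.fst_one.ne'
  · rw [(d1 1 one_mem_unit).derivWithin (hu 1 one_mem_unit), hV1]

/-- (Regularity of maximizers.) Let `α ∈ R_g^*` maximize
`λ_{1,p}` over `R_g` (`p ≥ 2n-1`). Then `α ∈ 𝒞`: it is `C¹` on `[0,1]`, has
constant speed `L_g(α)`, ends on `∂P ∖ {(0,0)}`, and meets `∂P` orthogonally. -/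
theorem simons_stmt18 (n : ℕ) (hn : 2 ≤ n) (cn : ℝ) (hcn : 0 < cn)
    (x0 y0 : ℝ) (hy0 : 0 < y0) (hxy : y0 ≤ x0)
    (p : ℝ) (hp : 2 * (n : ℝ) - 1 ≤ p)
    (α : ℝ → ℝ × ℝ) (hα : MemRgStar x0 y0 α)
    (hmax : ∀ γ : ℝ → ℝ × ℝ, MemRg x0 y0 γ → lambdaG n cn p γ ≤ lambdaG n cn p α) :
    MemC x0 y0 α := by
  obtain ⟨c, M, h⟩ := hα.exists_starData
  obtain ⟨D, hD, hDL, hDc, K, hK⟩ := h.exists_velocity hn hcn hp hmax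
  exact h.memC_of_velocity hD hDL hDc (h.tendsto_velocity hn hcn hp hmax hD hDL hDc hK)
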